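/- arXiv:2205.09200 — 7 statements merged into one kernel-verified Lean document; each statement's English description precedes it below -/
import Mathlib

section
/- Under Assumptions A4 and A5, the one-stage distributionally robust shortest path problem is equivalent to a robust shortest path problem with polyhedral uncertainty: min_{y∈Y} max_{Q∈Q} E_Q[c^⊤ y] = min_{y∈Y} max_{c̄∈S₀} c̄^⊤ y, where S₀ = {c̄ ∈ ℝ^A : L ≤ c̄ ≤ U, B c̄ ≤ b} and, for each arc a, L_a = min_{Q_a∈Q̃_a} E_{Q_a}[c_a] and U_a = max_{Q_a∈Q̃_a} E_{Q_a}[c_a]. -/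
open MeasureTheory

/-- The probability measures on `ℝ` that give each interval `[l j, u j]` a mass between `qlo j` and
`qhi j`. -/
def intervalAmbiguitySet {ι : Type*} (l u qlo qhi : ι → ℝ) : Set (Measure ℝ) :=
  {μ | IsProbabilityMeasure μ ∧
    ∀ j, (μ (Set.Icc (l j) (u j))).toReal ∈ Set.Icc (qlo j) (qhi j)}

/-- A probability measure carried by a compact interval has a finite mean. -/
lemma integrable_id_of_Icc_eq_one {μ : Measure ℝ} [IsProbabilityMeasure μ] {l u : ℝ}
    (h : μ (Set.Icc l u) = 1) : Integrable (fun x : ℝ => x) μ := by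
  have hae : ∀ᵐ x ∂μ, x ∈ Set.Icc l u := (prob_compl_eq_zero_iff measurableSet_Icc).2 h
  exact Integrable.of_mem_Icc l u measurable_id.aemeasurable hae

lemma integrable_id_of_mem_intervalAmbiguitySet {ι : Type*} {l u qlo qhi : ι → ℝ} {j : ι}
    (hj : qlo j = 1) {μ : Measure ℝ} (hμ : μ ∈ intervalAmbiguitySet l u qlo qhi) :
    Integrable (fun x : ℝ => x) μ := by
  have := hμ.1
  refine integrable_id_of_Icc_eq_one (l := l j) (u := u j) (le_antisymm prob_le_one ?_)
  have h : 1 ≤ (μ (Set.Icc (l j) (u j))).toReal := hj ▸ (hμ.2 j).1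
  simpa using (ENNReal.ofReal_le_iff_le_toReal (measure_ne_top μ _)).2 h

/-- Every value between two attained means is attained, since the ambiguity set is convex. -/
lemma exists_mem_intervalAmbiguitySet_integral_eq {ι : Type*} {l u qlo qhi : ι → ℝ}
    {μ ν : Measure ℝ} (hμ : μ ∈ intervalAmbiguitySet l u qlo qhi)
    (hν : ν ∈ intervalAmbiguitySet l u qlo qhi)
    (hμi : Integrable (fun x : ℝ => x) μ) (hνi : Integrable (fun x : ℝ => x) ν) {m : ℝ}
    (hm : m ∈ Set.Icc (∫ x, x ∂μ) (∫ x, x ∂ν)) :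
    ∃ ρ ∈ intervalAmbiguitySet l u qlo qhi, ∫ x, x ∂ρ = m := by
  rw [← segment_eq_Icc (hm.1.trans hm.2)] at hm
  obtain ⟨p, q, hp, hq, hpq, rfl⟩ := hm
  have := hμ.1
  have := hν.1
  lift p to NNReal using hp
  lift q to NNReal using hq
  have hpq' : p + q = 1 := by exact_mod_cast hpq
  refine ⟨p • μ + q • ν, ⟨⟨?_⟩, fun j => ?_⟩, ?_⟩
  · simp only [Measure.add_apply, Measure.smul_apply, measure_univ, ENNReal.smul_def,
      smul_eq_mul, mul_one]
    exact_mod_cast hpq'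
  · have h : ((p • μ + q • ν) (Set.Icc (l j) (u j))).toReal
        = (p : ℝ) • (μ (Set.Icc (l j) (u j))).toReal
          + (q : ℝ) • (ν (Set.Icc (l j) (u j))).toReal := by
      simp only [Measure.add_apply, Measure.smul_apply, ENNReal.smul_def, smul_eq_mul]
      rw [ENNReal.toReal_add (by finiteness) (by finiteness)]
      simp
    rw [h]
    exact convex_Icc _ _ (hμ.2 j) (hν.2 j) p.2 q.2 hpq
  · rw [integral_add_measure (hμi.smul_measure_nnreal) (hνi.smul_measure_nnreal),
      integral_smul_nnreal_measure, integral_smul_nnreal_measure]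
    rfl

/-- Expectations of linear forms depend only on the marginal means. -/
lemma integral_sum_mul_eq_sum_mul_integral_map {A : Type*} [Fintype A] {Q : Measure (A → ℝ)}
    (hQ : ∀ a, Integrable (fun x : ℝ => x) (Q.map (fun c => c a))) (w : A → ℝ) :
    ∫ c, (∑ a, w a * c a) ∂Q = ∑ a, w a * ∫ x, x ∂(Q.map (fun c => c a)) := by
  have hint : ∀ a, Integrable (fun c : A → ℝ => c a) Q := fun a =>
    (hQ a).comp_measurable (measurable_pi_apply a)
  rw [integral_finsetSum _ fun a _ => (hint a).const_mul (w a)]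
  refine Finset.sum_congr rfl fun a _ => ?_
  rw [integral_const_mul, integral_map (measurable_pi_apply a).aemeasurable (by fun_prop)]

/-- Under Assumptions A4 and A5, the one-stage distributionally robust
shortest path problem is equivalent to a robust shortest path problem with polyhedral
uncertainty: `min_{y∈Y} max_{Q∈Q} E_Q[cᵀy] = min_{y∈Y} max_{c̄∈S₀} c̄ᵀy`. -/
theorem one_stage_DRSPP_eq_robust_SPP
    {N A : Type*} [Fintype N] [Fintype A] [DecidableEq N]
    (tl hd : A → N) (s f : N)
    -- the set of incidence vectors of simple `s`-`f` paths
    (Ypaths : Set (A → ℝ))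
    (hY : Ypaths = {y : A → ℝ |
      (∀ a, y a = 0 ∨ y a = 1) ∧
      (∀ i : N, ((∑ a ∈ Finset.univ.filter (fun a => tl a = i), y a)
          - ∑ a ∈ Finset.univ.filter (fun a => hd a = i), y a)
          = if i = s then 1 else if i = f then -1 else 0) ∧
      (∀ i : N, (∑ a ∈ Finset.univ.filter (fun a => tl a = i), y a) ≤ 1)})
    -- data of the linear expectation constraints
    {k : ℕ} (B : Fin k → A → ℝ) (b : Fin k → ℝ)
    -- data of the individual probability constraints
    (d : A → ℕ) (hd0 : ∀ a, 0 < d a)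
    (l u : (a : A) → Fin (d a) → ℝ)
    (qlo qhi : (a : A) → Fin (d a) → ℝ)
    -- the first constraint of each arc is the support constraint
    (hsupp0 : ∀ a, 0 ≤ l a ⟨0, hd0 a⟩)
    (hsupp1 : ∀ a, l a ⟨0, hd0 a⟩ ≤ u a ⟨0, hd0 a⟩)
    (hsuppq : ∀ a, qlo a ⟨0, hd0 a⟩ = 1 ∧ qhi a ⟨0, hd0 a⟩ = 1)
    (hsub : ∀ a j, Set.Icc (l a j) (u a j) ⊆ Set.Icc (l a ⟨0, hd0 a⟩) (u a ⟨0, hd0 a⟩))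
    -- the one-dimensional ambiguity sets `Q̃_a`
    (Qtilde : (a : A) → Set (Measure ℝ))
    (hQtilde : ∀ a, Qtilde a = {μ | IsProbabilityMeasure μ ∧
        ∀ j, (μ (Set.Icc (l a j) (u a j))).toReal ∈ Set.Icc (qlo a j) (qhi a j)})
    -- the ambiguity set `Q`
    (Amb : Set (Measure (A → ℝ)))
    (hAmb : Amb = {Q | IsProbabilityMeasure Q ∧
        (∀ i : Fin k, (∫ c, (∑ a, B i a * c a) ∂Q) ≤ b i) ∧
        (∀ a, Measure.map (fun c => c a) Q ∈ Qtilde a)})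
    -- `L_a` and `U_a` are the minimal and maximal achievable means of arc `a`
    (L U : A → ℝ)
    (hL : ∀ a, IsLeast {m | ∃ μ ∈ Qtilde a, m = ∫ x, x ∂μ} (L a))
    (hU : ∀ a, IsGreatest {m | ∃ μ ∈ Qtilde a, m = ∫ x, x ∂μ} (U a))
    -- the polyhedral uncertainty set `S₀`
    (S0 : Set (A → ℝ))
    (hS0 : S0 = {cbar : A → ℝ | (∀ a, L a ≤ cbar a ∧ cbar a ≤ U a) ∧
        ∀ i : Fin k, (∑ a, B i a * cbar a) ≤ b i})
    -- Assumption A4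
    (hA4 : ∀ a, ∃ μ ∈ Qtilde a, ∀ j, qlo a j < qhi a j →
        (μ (Set.Icc (l a j) (u a j))).toReal ∈ Set.Ioo (qlo a j) (qhi a j))
    -- Assumption A5
    (hA5 : ∀ a, ∀ j₁ j₂ : Fin (d a), j₁ ≠ j₂ → l a j₁ ≠ u a j₂) :
    sInf {r | ∃ y ∈ Ypaths, r = sSup {e | ∃ Q ∈ Amb, e = ∫ c, (∑ a, c a * y a) ∂Q}}
      = sInf {r | ∃ y ∈ Ypaths, r = sSup {e | ∃ cbar ∈ S0, e = ∑ a, cbar a * y a}} := by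
  obtain rfl : Qtilde = fun a => intervalAmbiguitySet (l a) (u a) (qlo a) (qhi a) :=
    funext hQtilde
  subst hAmb hS0
  have hint : ∀ a, ∀ μ ∈ intervalAmbiguitySet (l a) (u a) (qlo a) (qhi a),
      Integrable (fun x : ℝ => x) μ := fun a μ hμ =>
    integrable_id_of_mem_intervalAmbiguitySet (hsuppq a).1 hμ
  congr! 7 with r y
  congr 1
  ext e
  constructor
  · rintro ⟨Q, ⟨-, hQb, hQm⟩, rfl⟩
    have hlin := integral_sum_mul_eq_sum_mul_integral_map fun a => hint a _ (hQm a)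
    refine ⟨fun a => ∫ x, x ∂(Q.map (fun c => c a)), ⟨fun a =>
      ⟨(hL a).2 ⟨_, hQm a, rfl⟩, (hU a).2 ⟨_, hQm a, rfl⟩⟩, fun i => ?_⟩, ?_⟩
    · rw [← hlin]
      exact hQb i
    · simpa only [mul_comm] using hlin y
  · rintro ⟨cbar, ⟨hbox, hB⟩, rfl⟩
    have hmarg : ∀ a, ∃ ρ ∈ intervalAmbiguitySet (l a) (u a) (qlo a) (qhi a),
        ∫ x, x ∂ρ = cbar a := fun a => by
      obtain ⟨μ, hμ, hLμ⟩ := (hL a).1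
      obtain ⟨ν, hν, hUν⟩ := (hU a).1
      exact exists_mem_intervalAmbiguitySet_integral_eq hμ hν (hint a μ hμ) (hint a ν hν)
        (hLμ ▸ hUν ▸ hbox a)
    choose ρ hρ hmean using hmarg
    have : ∀ a, IsProbabilityMeasure (ρ a) := fun a => (hρ a).1
    have hmap : ∀ a, (Measure.pi ρ).map (fun c => c a) = ρ a := fun a =>
      (measurePreserving_eval ρ a).map_eq
    have hlin : ∀ w : A → ℝ, ∫ c, (∑ a, w a * c a) ∂(Measure.pi ρ) = ∑ a, w a * cbar a := by
      intro w
      rw [integral_sum_mul_eq_sum_mul_integral_map fun a => (hmap a).symm ▸ hint a _ (hρ a)]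
      simp only [hmap, hmean]
    refine ⟨Measure.pi ρ, ⟨inferInstance, fun i => ?_, fun a => ?_⟩, ?_⟩
    · rw [hlin]
      exact hB i
    · rw [hmap]
      exact hρ a
    · simpa only [mul_comm] using (hlin y).symm
end

section
/- (Non-anticipativity for acyclic graphs.) Let G be a finite directed acyclic graph, let N' ⊆ N∖{f}, and let y_j, y_ℓ ∈ Y be incidence vectors of simple s–f paths P_j and P_ℓ. Suppose that for every node i ∈ N∖N': (a) if every node of N' is reachable from i by a directed path, then y_{j,a} = y_{ℓ,a} for all a ∈ FS_i; and (b) if the set Ñ ⊆ N' of nodes of N' not reachable from i is nonempty, then |y_{j,a} − y_{ℓ,a}| ≤ Σ_{n∈Ñ} Σ_{a'∈FS_n} y_{j,a'} for all a ∈ FS_i. Then P_j and P_ℓ share the same initial segment from s up to the first node of N' visited by P_j; in particular, if P_j visits no node of N', then P_j = P_ℓ. -/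
/-- The list of nodes visited by a list of arcs: the tail of the first arc followed by
the heads of all arcs. -/
def nodesOf {A N : Type*} (tl hd : A → N) : List A → List N
  | [] => []
  | a :: p => tl a :: (a :: p).map hd

/-- `p` is a simple directed path from `s` to `f`: it is a nonempty list of arcs, the
tail of the first arc is `s`, the head of the last arc is `f`, consecutive arcs are
incident, and no node is visited twice. -/
def IsSimplePath {A N : Type*} (tl hd : A → N) (s f : N) (p : List A) : Prop :=
  p ≠ [] ∧ (∀ a ∈ p.head?, tl a = s) ∧ (∀ a ∈ p.getLast?, hd a = f) ∧
    List.Chain' (fun a b => hd a = tl b) p ∧ (nodesOf tl hd p).Nodup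

/-- The (real-valued) incidence vector of a list of arcs. -/
noncomputable def incid {A : Type*} [DecidableEq A] (p : List A) : A → ℝ :=
  fun a => if a ∈ p then 1 else 0

/-- Reachability by a directed path. -/
def Reach {A N : Type*} (tl hd : A → N) (i n : N) : Prop :=
  Relation.ReflTransGen (fun x y => ∃ a, tl a = x ∧ hd a = y) i n

theorem nodesOf_eq_map_append {A N : Type*} (tl hd : A → N) :
    ∀ p : List A, List.IsChain (fun a b => hd a = tl b) p →
      nodesOf tl hd p = p.map tl ++ (p.getLast?.map hd).toList
  | [], _ => by simp [nodesOf]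
  | [a], _ => by simp [nodesOf]
  | a :: b :: p, h => by
    rw [List.isChain_cons_cons] at h
    have ih := nodesOf_eq_map_append tl hd (b :: p) h.2
    simp only [nodesOf, List.map_cons, List.cons_append, List.getLast?_cons_cons] at ih ⊢
    rw [h.1, ih]

theorem IsSimplePath.nodup_map_tl {A N : Type*} {tl hd : A → N} {s f : N} {p : List A}
    (h : IsSimplePath tl hd s f p) : (p.map tl).Nodup := by
  obtain ⟨-, -, -, hc, hn⟩ := h
  rw [nodesOf_eq_map_append tl hd p hc] at hn
  exact hn.of_append_left

theorem IsSimplePath.nodup_map_hd {A N : Type*} {tl hd : A → N} {s f : N} {p : List A}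
    (h : IsSimplePath tl hd s f p) : (p.map hd).Nodup := by
  obtain ⟨hne, -, -, -, hn⟩ := h
  cases p with
  | nil => exact absurd rfl hne
  | cons a p => exact (List.nodup_cons.mp hn).2

/-- A simple `s`–`f` path cannot be properly extended to another simple `s`–`f` path. -/
theorem IsSimplePath.eq_of_prefix {A N : Type*} {tl hd : A → N} {s f : N} {p q : List A}
    (hp : IsSimplePath tl hd s f p) (hq : IsSimplePath tl hd s f q) (h : p <+: q) : p = q := by
  obtain ⟨r, rfl⟩ := h
  rcases List.eq_nil_or_concat r with rfl | ⟨r, b, rfl⟩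
  · simp
  exfalso
  rcases List.eq_nil_or_concat p with rfl | ⟨p, a, rfl⟩
  · exact hp.1 rfl
  have ha : hd a = f := hp.2.2.1 a (by simp)
  have hb : hd b = f := hq.2.2.1 b (by simp [← List.append_assoc])
  have hn := hq.nodup_map_hd
  rw [List.map_append, List.nodup_append] at hn
  exact hn.2.2 (hd a) (by simp) (hd b) (by simp) (ha.trans hb.symm)

theorem reach_tl_of_isChain {A N : Type*} (tl hd : A → N) :
    ∀ (a : A) (p : List A), List.IsChain (fun a b => hd a = tl b) (a :: p) →
      ∀ b ∈ a :: p, Reach tl hd (tl a) (tl b)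
  | a, [], _, b, hb => by
    rw [List.mem_singleton.mp hb]
    exact Relation.ReflTransGen.refl
  | a, c :: p, h, b, hb => by
    rw [List.isChain_cons_cons] at h
    rcases List.mem_cons.mp hb with rfl | hb
    · exact Relation.ReflTransGen.refl
    · exact Relation.ReflTransGen.head ⟨a, rfl, h.1⟩ (reach_tl_of_isChain tl hd c p h.2 b hb)

/-- A walk whose arcs all lie on a walk `q` with the same start and with distinct tails
is an initial segment of `q`. -/
theorem prefix_of_subset_of_isChain {A N : Type*} (tl hd : A → N) (p q : List A) (u : N)
    (hp : List.IsChain (fun a b => hd a = tl b) p) (hq : List.IsChain (fun a b => hd a = tl b) q)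
    (hpu : ∀ a ∈ p.head?, tl a = u) (hqu : ∀ a ∈ q.head?, tl a = u)
    (hpn : p.Nodup) (hqn : (q.map tl).Nodup) (hsub : p ⊆ q) : p <+: q := by
  induction p generalizing q u with
  | nil => exact List.nil_prefix
  | cons a p ih =>
    cases q with
    | nil => exact absurd (hsub List.mem_cons_self) List.not_mem_nil
    | cons b q =>
      have hab : a = b := List.inj_on_of_nodup_map hqn (hsub List.mem_cons_self)
        List.mem_cons_self ((hpu a rfl).trans (hqu b rfl).symm)
      subst hab
      rw [List.isChain_cons] at hp hq
      rw [List.nodup_cons] at hpn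
      rw [List.map_cons, List.nodup_cons] at hqn
      refine (List.prefix_cons_inj a).mpr (ih q (hd a) hp.2 hq.2 (fun x hx => (hp.1 x hx).symm)
        (fun x hx => (hq.1 x hx).symm) hpn.2 hqn.2 fun x hx => ?_)
      rcases List.mem_cons.mp (hsub (List.mem_cons_of_mem a hx)) with rfl | h
      · exact absurd hx hpn.1
      · exact h

/-- (Non-anticipativity for acyclic graphs.)  If `G` is acyclic and the
incidence vectors `y_j, y_ℓ` of two simple `s`–`f` paths satisfy the non-anticipativity
constraints (4a)–(4b) with respect to `N' ⊆ N∖{f}`, then the two paths share the same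
initial segment from `s` up to the first node of `N'` visited by `P_j`; in particular,
if `P_j` visits no node of `N'`, then `P_j = P_ℓ`. -/
theorem non_anticipativity_acyclic
    {N A : Type*} [Fintype N] [Fintype A] [DecidableEq N] [DecidableEq A]
    (tl hd : A → N) (s f : N)
    -- the graph is acyclic
    (hacyc : ¬ ∃ x : N, Relation.TransGen (fun x y => ∃ a, tl a = x ∧ hd a = y) x x)
    -- `N' ⊆ N ∖ {f}`
    (Nset : Finset N) (hNf : f ∉ Nset)
    -- two simple `s`–`f` paths and their incidence vectors
    (pj pl : List A)
    (hpj : IsSimplePath tl hd s f pj) (hpl : IsSimplePath tl hd s f pl)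
    -- for each node `i`, the subset `Ñ` of nodes of `N'` not reachable from `i`
    (Ntilde : N → Finset N)
    (hNtilde : ∀ i n, n ∈ Ntilde i ↔ n ∈ Nset ∧ ¬ Reach tl hd i n)
    -- constraint (4a): if every node of `N'` is reachable from `i ∉ N'`
    (h4a : ∀ i : N, i ∉ Nset → (∀ n ∈ Nset, Reach tl hd i n) →
      ∀ a, tl a = i → incid pj a = incid pl a)
    -- constraint (4b): if some node of `N'` is not reachable from `i ∉ N'`
    (h4b : ∀ i : N, i ∉ Nset → (Ntilde i).Nonempty →
      ∀ a, tl a = i → |incid pj a - incid pl a| ≤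
        ∑ n ∈ Ntilde i, ∑ a' ∈ Finset.univ.filter (fun a' => tl a' = n), incid pj a') :
    (∀ kk : ℕ, (∀ x ∈ (nodesOf tl hd pj).take kk, x ∉ Nset) → pj.take kk = pl.take kk) ∧
    ((∀ x ∈ nodesOf tl hd pj, x ∉ Nset) → pj = pl) := by
  have hmem : ∀ q a r, pj = q ++ a :: r → (∀ b ∈ q, tl b ∉ Nset) → tl a ∉ Nset → a ∈ pl := by
    intro q a r hpq hq ha
    have heq : incid pj a = incid pl a := by
      by_cases hne : (Ntilde (tl a)).Nonempty
      · have hle := h4b (tl a) ha hne a rfl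
        rw [Finset.sum_eq_zero] at hle
        · exact sub_eq_zero.mp (abs_nonpos_iff.mp hle)
        intro n hn
        obtain ⟨hnN, hnr⟩ := (hNtilde _ _).mp hn
        refine Finset.sum_eq_zero fun a' ha' => if_neg fun hmem => ?_
        obtain rfl : tl a' = n := (Finset.mem_filter.mp ha').2
        rw [hpq, List.mem_append] at hmem
        rcases hmem with h | h
        · exact hq a' h hnN
        · have hc : List.IsChain (fun a b => hd a = tl b) pj := hpj.2.2.2.1
          rw [hpq, List.isChain_append] at hc
          exact hnr (reach_tl_of_isChain tl hd a r hc.2.1 a' h)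
      · refine h4a (tl a) ha (fun n hn => ?_) a rfl
        by_contra hr
        exact hne ⟨n, (hNtilde _ _).mpr ⟨hn, hr⟩⟩
    by_contra hal
    have haj : a ∈ pj := by simp [hpq]
    simp [incid, haj, hal] at heq
  have hprefix : ∀ kk : ℕ, (∀ x ∈ (nodesOf tl hd pj).take kk, x ∉ Nset) →
      pj.take kk <+: pl := by
    intro kk hkk
    have htl : ∀ b ∈ pj.take kk, tl b ∉ Nset := by
      intro b hb
      refine hkk _ ?_
      rw [nodesOf_eq_map_append tl hd pj hpj.2.2.2.1, List.take_append, ← List.map_take]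
      exact List.mem_append_left _ (List.mem_map_of_mem hb)
    refine prefix_of_subset_of_isChain tl hd _ pl s (hpj.2.2.2.1.take kk) hpl.2.2.2.1
      (fun a ha => ?_) hpl.2.1 ((hpj.nodup_map_tl.of_map tl).sublist (List.take_sublist kk pj))
      hpl.nodup_map_tl fun a ha => ?_
    · rw [List.head?_take] at ha
      split_ifs at ha
      · simp at ha
      · exact hpj.2.1 a ha
    · obtain ⟨q, r, hqr⟩ := List.append_of_mem ha
      refine hmem q a (r ++ pj.drop kk) ?_ (fun b hb => htl b (by simp [hqr, hb])) (htl a ha)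
      rw [← List.cons_append, ← List.append_assoc, ← hqr, List.take_append_drop]
  refine ⟨fun kk hkk => ?_, fun h => ?_⟩
  · have hp := hprefix kk hkk
    rcases le_total kk pj.length with hle | hle
    · have h := List.prefix_iff_eq_take.mp hp
      rwa [List.length_take_of_le hle] at h
    · rw [List.take_of_length_le hle] at hp
      rw [hpj.eq_of_prefix hpl hp]
  · have hp := hprefix pj.length fun x hx => h x (List.mem_of_mem_take hx)
    rw [List.take_length] at hp
    exact hpj.eq_of_prefix hpl hp
end

section
/- (Non-anticipativity for general graphs.) Let G be a finite directed graph, N' ⊆ N∖{f}, and let y_j, y_ℓ ∈ Y be incidence vectors of simple s–f paths P_j and P_ℓ. Let t_j ∈ ℝ^N satisfy t_{j,s} = 0, 0 ≤ t_{j,i} ≤ |N|−1 for all i ∈ N, and t_{j,a₁} − t_{j,a₂} ≤ −1 + |N|·(1 − y_{j,a}) for every arc a = (a₁, a₂) ∈ A. Suppose that for every i ∈ N∖N' and every a ∈ FS_i, |y_{j,a} − y_{ℓ,a}| ≤ Σ_{n∈N'} min{ max{t_{j,i} − t_{j,n}, 0} + 2 − Σ_{a'∈FS_n} y_{j,a'}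 − Σ_{a'∈FS_i} y_{j,a'} ; Σ_{a'∈FS_n} y_{j,a'} }. Then P_j and P_ℓ share the same initial segment from s up to the first node of N' visited by P_j; in particular, if P_j visits no node of N', then P_j = P_ℓ. -/
section SimplePath

variable {A N : Type*} {tl hd : A → N} {s f : N} {p q : List A}

theorem length_nodesOf (hp : p ≠ []) : (nodesOf tl hd p).length = p.length + 1 := by
  cases p <;> simp_all [nodesOf]

theorem getElem_succ_nodesOf {k : ℕ} (hk : k < p.length)
    (hk' : k + 1 < (nodesOf tl hd p).length) : (nodesOf tl hd p)[k + 1] = hd p[k] := by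
  cases p with
  | nil => simp at hk
  | cons a p => simp only [nodesOf, List.getElem_cons_succ, List.getElem_map]

namespace IsSimplePath

theorem tl_zero (hp : IsSimplePath tl hd s f p) (h0 : 0 < p.length) : tl p[0] = s :=
  hp.2.1 _ (by simp [List.head?_eq_getElem?, h0])

theorem hd_eq_tl_succ (hp : IsSimplePath tl hd s f p) {k : ℕ} (hk : k + 1 < p.length) :
    hd p[k] = tl p[k + 1] :=
  List.isChain_iff_getElem.1 hp.2.2.2.1 k hk

theorem getElem_nodesOf (hp : IsSimplePath tl hd s f p) {k : ℕ} (hk : k < p.length)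
    (hk' : k < (nodesOf tl hd p).length) : (nodesOf tl hd p)[k] = tl p[k] := by
  cases k with
  | zero =>
    cases p with
    | nil => simp at hk
    | cons a p => rfl
  | succ k => rw [getElem_succ_nodesOf (by omega), hp.hd_eq_tl_succ]

theorem tl_injective (hp : IsSimplePath tl hd s f p) {i j : ℕ} (hi : i < p.length)
    (hj : j < p.length) (h : tl p[i] = tl p[j]) : i = j := by
  have hlen := length_nodesOf (tl := tl) (hd := hd) hp.1
  refine (hp.2.2.2.2.getElem_inj_iff (hi := by omega) (hj := by omega)).1 ?_
  rw [hp.getElem_nodesOf hi, hp.getElem_nodesOf hj, h]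

theorem hd_injective (hp : IsSimplePath tl hd s f p) {i j : ℕ} (hi : i < p.length)
    (hj : j < p.length) (h : hd p[i] = hd p[j]) : i = j := by
  have hlen := length_nodesOf (tl := tl) (hd := hd) hp.1
  have := (hp.2.2.2.2.getElem_inj_iff (i := i + 1) (j := j + 1)
    (hi := by omega) (hj := by omega)).1
    (by rw [getElem_succ_nodesOf hi, getElem_succ_nodesOf hj, h])
  omega

theorem hd_last (hp : IsSimplePath tl hd s f p) (h : p.length - 1 < p.length) :
    hd p[p.length - 1] = f :=
  hp.2.2.1 _ (by simp [List.getLast?_eq_getElem?, h])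

/-- No simple `s`–`f` path properly extends another one. -/
theorem eq_of_prefix_s8 (hp : IsSimplePath tl hd s f p) (hq : IsSimplePath tl hd s f q)
    (h : p <+: q) : p = q := by
  have hp0 := List.length_pos_iff.2 hp.1
  have hle := h.length_le
  refine h.eq_of_length ?_
  have hlast : hd q[p.length - 1] = f := by
    rw [← h.getElem (by omega)]
    exact hp.hd_last (by omega)
  have := hq.hd_injective (by omega) (by omega) (hlast.trans (hq.hd_last (by omega)).symm)
  omega

/-- Labels that do not decrease along the arcs of a path are monotone along its nodes. -/
theorem label_mono (hp : IsSimplePath tl hd s f p) {t : N → ℝ}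
    (ht : ∀ a ∈ p, t (tl a) ≤ t (hd a)) {i j : ℕ} (hij : i ≤ j) (hj : j < p.length) :
    t (tl p[i]) ≤ t (tl p[j]) := by
  induction j, hij using Nat.le_induction with
  | base => rfl
  | succ j hij ih =>
    rw [← hp.hd_eq_tl_succ hj]
    exact (ih (by omega)).trans (ht _ (List.getElem_mem _))

/-- If two simple paths agree on their first `k` arcs, and the `k`-th arc of the first one
lies on the second one, then it is the `k`-th arc of the second one. -/
theorem getElem?_eq_of_mem (hp : IsSimplePath tl hd s f p) (hq : IsSimplePath tl hd s f q)
    {k : ℕ} (hk : k < p.length) (hmem : p[k] ∈ q) (htake : p.take k = q.take k) :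
    q[k]? = some p[k] := by
  have hq0 := List.length_pos_iff.2 hq.1
  obtain ⟨r, hr, hrk⟩ := List.getElem_of_mem hmem
  suffices r = k by subst this; rw [List.getElem?_eq_getElem hr, hrk]
  cases k with
  | zero => exact hq.tl_injective hr hq0 (by rw [hrk, hp.tl_zero, hq.tl_zero])
  | succ k =>
    have hlen := congrArg List.length htake
    simp only [List.length_take] at hlen
    have hqp : q[k] = p[k] := by
      have := congrArg (·[k]?) htake
      simp only [List.getElem?_take, Nat.lt_succ_self, if_true] at this
      rw [List.getElem?_eq_getElem (by omega), List.getElem?_eq_getElem (by omega)] at this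
      exact (Option.some.inj this).symm
    have hr_tl : tl q[r] = hd q[k] := by rw [hrk, ← hp.hd_eq_tl_succ hk, hqp]
    have hr0 : r ≠ 0 := by
      rintro rfl
      have h := hp.tl_injective hk (j := 0) (by omega) (by rw [← hrk, hq.tl_zero, hp.tl_zero])
      omega
    obtain ⟨r, rfl⟩ := Nat.exists_eq_succ_of_ne_zero hr0
    rw [← hq.hd_eq_tl_succ hr] at hr_tl
    rw [hq.hd_injective (by omega) (by omega) hr_tl]

end IsSimplePath

end SimplePath

section Incidence

theorem incid_nonneg {A : Type*} [DecidableEq A] (p : List A) (a : A) : 0 ≤ incid p a := by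
  unfold incid; split_ifs <;> norm_num

variable {A N : Type*} [Fintype A] [DecidableEq N] [DecidableEq A] {p : List A} {tl : A → N}

theorem one_le_outflow {a : A} (ha : a ∈ p) :
    1 ≤ ∑ a' ∈ Finset.univ.filter (fun a' => tl a' = tl a), incid p a' := by
  have := Finset.single_le_sum (f := incid p) (fun a' _ => incid_nonneg p a')
    (show a ∈ Finset.univ.filter (fun a' => tl a' = tl a) by simp)
  simpa [incid, ha] using this

theorem outflow_eq_zero {n : N} (hn : ∀ a ∈ p, tl a ≠ n) :
    ∑ a' ∈ Finset.univ.filter (fun a' => tl a' = n), incid p a' = 0 := by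
  refine Finset.sum_eq_zero fun a ha => if_neg fun hap => hn a hap ?_
  simpa using ha

end Incidence

/-- (Non-anticipativity for general graphs.)  If the incidence vectors
`y_j, y_ℓ` of two simple `s`–`f` paths satisfy the MTZ-labelled non-anticipativity
constraints (5a)–(5d) with respect to `N' ⊆ N∖{f}`, then the two paths share the same
initial segment from `s` up to the first node of `N'` visited by `P_j`; in particular,
if `P_j` visits no node of `N'`, then `P_j = P_ℓ`. -/
theorem non_anticipativity_general
    {N A : Type*} [Fintype N] [Fintype A] [DecidableEq N] [DecidableEq A]
    (tl hd : A → N) (s f : N)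
    -- `N' ⊆ N ∖ {f}`
    (Nset : Finset N) (hNf : f ∉ Nset)
    -- two simple `s`–`f` paths
    (pj pl : List A)
    (hpj : IsSimplePath tl hd s f pj) (hpl : IsSimplePath tl hd s f pl)
    -- MTZ labels for the path `P_j`
    (t : N → ℝ)
    (ht0 : t s = 0)
    (htbd : ∀ i : N, 0 ≤ t i ∧ t i ≤ (Fintype.card N : ℝ) - 1)
    (htarc : ∀ a : A, t (tl a) - t (hd a) ≤ -1 + (Fintype.card N : ℝ) * (1 - incid pj a))
    -- the non-anticipativity constraint (5d)
    (h5d : ∀ i : N, i ∉ Nset → ∀ a, tl a = i →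
      |incid pj a - incid pl a| ≤ ∑ n ∈ Nset,
        min (max (t i - t n) 0 + 2
              - (∑ a' ∈ Finset.univ.filter (fun a' => tl a' = n), incid pj a')
              - (∑ a' ∈ Finset.univ.filter (fun a' => tl a' = i), incid pj a'))
            (∑ a' ∈ Finset.univ.filter (fun a' => tl a' = n), incid pj a')) :
    (∀ kk : ℕ, (∀ x ∈ (nodesOf tl hd pj).take kk, x ∉ Nset) → pj.take kk = pl.take kk) ∧
    ((∀ x ∈ nodesOf tl hd pj, x ∉ Nset) → pj = pl) := by
  have hlen := length_nodesOf (tl := tl) (hd := hd) hpj.1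
  have hmono : ∀ a ∈ pj, t (tl a) ≤ t (hd a) := by
    intro a ha
    have h := htarc a
    simp only [incid, if_pos ha] at h
    linarith
  have hshared : ∀ k (hk : k < pj.length),
      (∀ x ∈ (nodesOf tl hd pj).take (k + 1), x ∉ Nset) → pj[k] ∈ pl := by
    intro k hk hx
    have htail : ∀ r (hr : r ≤ k), tl pj[r] ∉ Nset := by
      intro r hr
      rw [← hpj.getElem_nodesOf (by omega) (by omega)]
      exact hx _ (List.mem_take_iff_getElem.2 ⟨r, by omega, rfl⟩)
    have hle := (h5d _ (htail k le_rfl) pj[k] rfl).trans (Finset.sum_nonpos ?_)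
    · by_contra hmem
      simp [incid, hmem] at hle
      linarith
    · intro n hn
      by_cases hvis : ∃ a ∈ pj, tl a = n
      · obtain ⟨a, ha, rfl⟩ := hvis
        refine (min_le_left _ _).trans ?_
        have hout := one_le_outflow (tl := tl) ha
        have hout' := one_le_outflow (tl := tl) (List.getElem_mem hk)
        obtain ⟨r, hr, rfl⟩ := List.getElem_of_mem ha
        have hkr : k ≤ r := by
          by_contra hlt
          exact htail r (by omega) hn
        rw [max_eq_right (sub_nonpos.2 (hpj.label_mono hmono hkr hr))]
        linarith
      · exact (min_le_right _ _).trans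
          (outflow_eq_zero fun a ha han => hvis ⟨a, ha, han⟩).le
  have hinit : ∀ k ≤ pj.length,
      (∀ x ∈ (nodesOf tl hd pj).take k, x ∉ Nset) → pj.take k = pl.take k := by
    intro k
    induction k with
    | zero => simp
    | succ k ih =>
      intro hk hx
      have htake := ih (by omega) fun x hxk =>
        hx x ((List.take_prefix_take_left (Nat.le_succ k)).subset hxk)
      have hnext := hpj.getElem?_eq_of_mem hpl hk (hshared k hk hx) htake
      rw [List.take_add_one, List.take_add_one, htake, hnext, List.getElem?_eq_getElem hk]
  have hfull : (∀ x ∈ (nodesOf tl hd pj).take pj.length, x ∉ Nset) → pj = pl := by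
    intro hx
    refine hpj.eq_of_prefix_s8 hpl ?_
    rw [List.prefix_iff_eq_take, ← hinit _ le_rfl hx, List.take_length]
  refine ⟨fun k hx => ?_, fun hx => hfull fun x hxk => hx x (List.mem_of_mem_take hxk)⟩
  rcases le_total k pj.length with hk | hk
  · exact hinit k hk hx
  · rw [hfull fun x hxk => hx x ((List.take_prefix_take_left hk).subset hxk)]
end

section
/- Let y ∈ Y be the incidence vector of a simple s–f path P, and let t ∈ ℝ^N satisfy t_s = 0, 0 ≤ t_i ≤ |N|−1 for all i, and t_{a₁} − t_{a₂} ≤ −1 + |N|·(1 − y_a) for every arc a = (a₁, a₂). For nodes i, n ∈ N write out(i) = Σ_{a'∈FS_i} y_{a'} ∈ {0,1} and define w_{i,n} = min{ max{t_i − t_n, 0} + 2 − out(n) − out(i) ; out(n) }. Then: w_{i,n} = 0 if out(n) = 0, or if out(i) = out(n) = 1 and i strictly precedes n on P; and w_{i,n} = 1 if out(n) = 1 and either out(i) = 0 or n strictly precedes i on P. -/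
/-- Node `i` occurs strictly before node `n` on the path `p`. -/
def StrictlyPrecedes {A N : Type*} (tl hd : A → N) (p : List A) (i n : N) : Prop :=
  ∃ ki kn : ℕ, ki < kn ∧ (nodesOf tl hd p)[ki]? = some i ∧ (nodesOf tl hd p)[kn]? = some n

theorem nodesOf_cons_cons {A N : Type*} {tl hd : A → N} {a b : A} (h : hd a = tl b)
    (p : List A) : nodesOf tl hd (a :: b :: p) = tl a :: nodesOf tl hd (b :: p) := by
  simp [nodesOf, h]

/-- The tails of the arcs of a walk form a sublist of its nodes. -/
theorem map_tail_sublist_nodesOf {A N : Type*} {tl hd : A → N} {p : List A}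
    (hp : List.IsChain (fun a b => hd a = tl b) p) :
    (p.map tl).Sublist (nodesOf tl hd p) := by
  induction hp with
  | nil => simp
  | singleton a => simp [nodesOf]
  | cons_cons h _ ih =>
    rw [nodesOf_cons_cons h, List.map_cons]
    exact ih.cons_cons _

/-- A relation that links the ends of every arc of a walk links consecutive nodes. -/
theorem isChain_nodesOf {A N : Type*} {tl hd : A → N} {R : N → N → Prop} {p : List A}
    (hp : List.IsChain (fun a b => hd a = tl b) p) (hR : ∀ a ∈ p, R (tl a) (hd a)) :
    List.IsChain R (nodesOf tl hd p) := by
  induction hp with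
  | nil => simp [nodesOf]
  | singleton a => simpa [nodesOf] using hR a
  | @cons_cons a b l h _ ih =>
    rw [nodesOf_cons_cons h]
    refine List.IsChain.cons_cons ?_ (ih fun c hc => hR c (List.mem_cons_of_mem _ hc))
    exact h ▸ hR a List.mem_cons_self

/-- Labels that grow by at least one along every arc grow by at least one between any two
distinct positions of the walk. -/
theorem StrictlyPrecedes.add_one_le {A N : Type*} {tl hd : A → N} {p : List A} {t : N → ℝ}
    {i n : N} (h : StrictlyPrecedes tl hd p i n)
    (hp : List.IsChain (fun a b => hd a = tl b) p)
    (ht : ∀ a ∈ p, t (tl a) + 1 ≤ t (hd a)) : t i + 1 ≤ t n := by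
  let R : N → N → Prop := fun x y => t x + 1 ≤ t y
  have : IsTrans N R := ⟨fun x y z hxy hyz => by simp only [R] at *; linarith⟩
  have hR : (nodesOf tl hd p).Pairwise R := (isChain_nodesOf hp ht).pairwise
  obtain ⟨ki, kn, hlt, hi, hn⟩ := h
  obtain ⟨hki, rfl⟩ := List.getElem?_eq_some_iff.1 hi
  obtain ⟨hkn, rfl⟩ := List.getElem?_eq_some_iff.1 hn
  exact List.pairwise_iff_getElem.1 hR ki kn hki hkn hlt

/-- At most one arc of a simple path leaves a given node. -/
theorem IsSimplePath.sum_incid_le_one {A N : Type*} [Fintype A] [DecidableEq N]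
    [DecidableEq A] {tl hd : A → N} {s f : N} {p : List A} (hp : IsSimplePath tl hd s f p)
    (i : N) : ∑ a ∈ Finset.univ.filter (fun a => tl a = i), incid p a ≤ 1 := by
  obtain ⟨-, -, -, hchain, hnodup⟩ := hp
  have hinj := List.inj_on_of_nodup_map (hnodup.sublist (map_tail_sublist_nodesOf hchain))
  simp only [incid, Finset.sum_boole]
  norm_cast
  rw [Finset.card_le_one]
  intro a ha b hb
  simp only [Finset.mem_filter, Finset.mem_univ, true_and] at ha hb
  exact hinj ha.2 hb.2 (ha.1.trans hb.1.symm)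

/-- For a simple `s`–`f` path with MTZ labels `t`, the indicator
`w_{i,n} = min{max{t_i − t_n, 0} + 2 − out(n) − out(i); out(n)}` equals `0` when
`out(n) = 0`, or when `out(i) = out(n) = 1` and `i` strictly precedes `n` on `P`; and it
equals `1` when `out(n) = 1` and either `out(i) = 0` or `n` strictly precedes `i`. -/
theorem MTZ_indicator_values
    {N A : Type*} [Fintype N] [Fintype A] [DecidableEq N] [DecidableEq A]
    (tl hd : A → N) (s f : N)
    (p : List A) (hp : IsSimplePath tl hd s f p)
    (t : N → ℝ)
    (ht0 : t s = 0)
    (htbd : ∀ i : N, 0 ≤ t i ∧ t i ≤ (Fintype.card N : ℝ) - 1)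
    (htarc : ∀ a : A, t (tl a) - t (hd a) ≤ -1 + (Fintype.card N : ℝ) * (1 - incid p a))
    (out : N → ℝ)
    (hout : ∀ i : N, out i = ∑ a' ∈ Finset.univ.filter (fun a' => tl a' = i), incid p a')
    (w : N → N → ℝ)
    (hw : ∀ i n : N, w i n = min (max (t i - t n) 0 + 2 - out n - out i) (out n)) :
    (∀ i n : N, out n = 0 → w i n = 0) ∧
    (∀ i n : N, out i = 1 → out n = 1 → StrictlyPrecedes tl hd p i n → w i n = 0) ∧
    (∀ i n : N, out n = 1 → out i = 0 → w i n = 1) ∧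
    (∀ i n : N, out n = 1 → StrictlyPrecedes tl hd p n i → w i n = 1) := by
  have hle (i : N) : out i ≤ 1 := hout i ▸ hp.sum_incid_le_one i
  have harc : ∀ a ∈ p, t (tl a) + 1 ≤ t (hd a) := by
    intro a ha
    have := htarc a
    simp only [incid, if_pos ha, sub_self, mul_zero] at this
    linarith
  have hchain := hp.2.2.2.1
  refine ⟨fun i n hn => ?_, fun i n hi hn h => ?_, fun i n hn hi => ?_, fun i n hn h => ?_⟩
  · rw [hw, hn, min_eq_right]
    linarith [hle i, le_max_right (t i - t n) 0]
  · have := h.add_one_le hchain harc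
    rw [hw, hn, hi, max_eq_right (by linarith)]
    norm_num
  · rw [hw, hn, hi, min_eq_right]
    linarith [le_max_right (t i - t n) 0]
  · have := h.add_one_le hchain harc
    rw [hw, hn, min_eq_right]
    linarith [hle i, le_max_left (t i - t n) 0]
end

section
/- (LP duality for the shortest path polytope.) Let G=(N,A) be a finite directed graph in which f is reachable from s, and let c ∈ ℝ^A be nonnegative. Then min_{y∈Y} c^⊤ y = max { μ_s − μ_f : μ ∈ ℝ^N, μ_i − μ_{i'} ≤ c_a for every arc a = (i, i') ∈ A }, i.e., the minimum cost of a simple directed s–f path equals the optimal value of the dual shortest path linear program over node potentials. -/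
namespace ShortestPath

open Finset

variable {N A : Type*} [Fintype A] [DecidableEq N]

/-- The net outflow of `y` at the node `i`. -/
def netOutflow (tl hd : A → N) (y : A → ℝ) (i : N) : ℝ :=
  ∑ a ∈ univ.filter (fun a => tl a = i), y a - ∑ a ∈ univ.filter (fun a => hd a = i), y a

/-- `y` is a unit flow from `s` to `x`, given by a 0-1 vector with at most one arc out of each node
and none out of `x`, which uses only arcs inside `U` that are tight for the potential `μ`. -/
structure IsTightPath (tl hd : A → N) (c : A → ℝ) (μ : N → ℝ) (U : Finset N) (s x : N)
    (y : A → ℝ) : Prop where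
  zero_or_one : ∀ a, y a = 0 ∨ y a = 1
  tail_mem : ∀ a, y a ≠ 0 → tl a ∈ U
  head_mem : ∀ a, y a ≠ 0 → hd a ∈ U
  tight : ∀ a, y a ≠ 0 → μ (tl a) - μ (hd a) = c a
  flow : ∀ i, netOutflow tl hd y i = (if i = s then 1 else 0) - (if i = x then 1 else 0)
  outflow_le : ∀ i, ∑ a ∈ univ.filter (fun a => tl a = i), y a ≤ 1
  eq_zero_of_tail : ∀ a, tl a = x → y a = 0

/-- Every node of `U` is reached from `s` by a path inside `U` that is tight for a common feasible
potential. -/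
def IsLabelled (tl hd : A → N) (c : A → ℝ) (s : N) (U : Finset N) : Prop :=
  s ∈ U ∧ ∃ μ : N → ℝ, (∀ a, μ (tl a) - μ (hd a) ≤ c a) ∧
    ∀ x ∈ U, ∃ y, IsTightPath tl hd c μ U s x y

/-- Summation by parts: pairing a flow with potential differences along the arcs. -/
lemma sum_potential_diff_mul [Fintype N] (tl hd : A → N) (μ : N → ℝ) (y : A → ℝ) :
    ∑ a, (μ (tl a) - μ (hd a)) * y a = ∑ i, μ i * netOutflow tl hd y i := by
  have key (g : A → N) :
      ∑ i, μ i * ∑ a ∈ univ.filter (fun a => g a = i), y a = ∑ a, μ (g a) * y a := by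
    rw [← sum_fiberwise univ g (fun a => μ (g a) * y a)]
    refine sum_congr rfl fun i _ => ?_
    rw [mul_sum]
    refine sum_congr rfl fun a ha => ?_
    rw [(mem_filter.1 ha).2]
  simp only [netOutflow, mul_sub, sub_mul, sum_sub_distrib, key]

lemma sum_potential_mul_ite [Fintype N] {s f : N} (hsf : s ≠ f) (μ : N → ℝ) :
    ∑ i, μ i * (if i = s then 1 else if i = f then -1 else 0 : ℝ) = μ s - μ f := by
  have h (i : N) : μ i * (if i = s then 1 else if i = f then -1 else 0 : ℝ)
      = (if i = s then μ i else 0) - (if i = f then μ i else 0) := by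
    by_cases h1 : i = s
    · subst h1; simp [hsf]
    · by_cases h2 : i = f <;> simp [h1, h2, hsf.symm]
  simp [h, sum_sub_distrib]

/-- An arc leaves every node set that separates `s` from a node reachable from `s`. -/
lemma exists_arc_leaving {tl hd : A → N} {s f : N}
    (h : Relation.ReflTransGen (fun x y => ∃ a, tl a = x ∧ hd a = y) s f)
    {U : Finset N} (hs : s ∈ U) (hf : f ∉ U) : ∃ a, tl a ∈ U ∧ hd a ∉ U := by
  by_contra! hclosed
  apply hf
  induction h with
  | refl => exact hs
  | tail _ hstep ih =>
    obtain ⟨a, rfl, rfl⟩ := hstep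
    exact hclosed a (by_contra fun h => h (ih h))

lemma isLabelled_singleton {tl hd : A → N} {c : A → ℝ} (hc : ∀ a, 0 ≤ c a) (s : N) :
    IsLabelled tl hd c s {s} := by
  refine ⟨by simp, 0, by simpa using hc, fun x hx => ⟨0, ?_⟩⟩
  obtain rfl := mem_singleton.1 hx
  constructor <;> simp [netOutflow]

lemma IsTightPath.mono {tl hd : A → N} {c : A → ℝ} {μ ν : N → ℝ} {U V : Finset N} {s x : N}
    {y : A → ℝ} (h : IsTightPath tl hd c μ U s x y) (hUV : U ⊆ V)
    (hν : ∀ a, tl a ∈ U → hd a ∈ U → ν (tl a) - ν (hd a) = μ (tl a) - μ (hd a)) :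
    IsTightPath tl hd c ν V s x y where
  zero_or_one := h.zero_or_one
  tail_mem a ha := hUV (h.tail_mem a ha)
  head_mem a ha := hUV (h.head_mem a ha)
  tight a ha := (hν a (h.tail_mem a ha) (h.head_mem a ha)).trans (h.tight a ha)
  flow := h.flow
  outflow_le := h.outflow_le
  eq_zero_of_tail := h.eq_zero_of_tail

/-- A tight path is prolonged by a tight arc to a new node. -/
lemma IsTightPath.extend [DecidableEq A] {tl hd : A → N} {c : A → ℝ} {μ : N → ℝ} {U : Finset N}
    {s : N} {y : A → ℝ} {b : A} (h : IsTightPath tl hd c μ U s (tl b) y) (hb : tl b ∈ U)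
    (hb' : hd b ∉ U) (hbt : μ (tl b) - μ (hd b) = c b) :
    IsTightPath tl hd c μ (insert (hd b) U) s (hd b) (y + Pi.single b 1) := by
  have hyb : y b = 0 := h.eq_zero_of_tail b rfl
  have hne (a : A) (ha : (y + Pi.single b 1 : A → ℝ) a ≠ 0) : a = b ∨ y a ≠ 0 := by
    by_cases hab : a = b
    · exact .inl hab
    · exact .inr (by simpa [hab] using ha)
  have hsum (g : A → N) (i : N) :
      ∑ a ∈ univ.filter (fun a => g a = i), (y + Pi.single b 1 : A → ℝ) a
        = ∑ a ∈ univ.filter (fun a => g a = i), y a + if i = g b then 1 else 0 := by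
    simp only [Pi.add_apply, sum_add_distrib, sum_pi_single', mem_filter, mem_univ, true_and,
      eq_comm (a := i)]
  refine ⟨fun a => ?_, fun a ha => ?_, fun a ha => ?_, fun a ha => ?_, fun i => ?_, fun i => ?_,
    fun a ha => ?_⟩
  · by_cases hab : a = b
    · subst hab; simp [hyb]
    · simpa [hab] using h.zero_or_one a
  · rcases hne a ha with rfl | ha
    · exact mem_insert_of_mem hb
    · exact mem_insert_of_mem (h.tail_mem a ha)
  · rcases hne a ha with rfl | ha
    · exact mem_insert_self _ _
    · exact mem_insert_of_mem (h.head_mem a ha)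
  · rcases hne a ha with rfl | ha
    · exact hbt
    · exact h.tight a ha
  · have := h.flow i
    simp only [netOutflow] at this
    simp only [netOutflow, hsum]
    linarith
  · rw [hsum]
    split_ifs with hi
    · rw [sum_eq_zero fun a ha => h.eq_zero_of_tail a ((mem_filter.1 ha).2.trans hi), zero_add]
    · simpa using h.outflow_le i
  · by_contra hya
    rcases hne a hya with rfl | hya
    · exact hb' (ha ▸ hb)
    · exact hb' (ha ▸ h.tail_mem a hya)

/-- One step of Dijkstra's algorithm: raise the potential on `U` until an arc leaving `U` becomes
tight, and add the head of that arc. -/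
lemma IsLabelled.exists_insert {tl hd : A → N} {c : A → ℝ} {s : N} {U : Finset N}
    (h : IsLabelled tl hd c s U) (hU : ∃ a, tl a ∈ U ∧ hd a ∉ U) :
    ∃ z ∉ U, IsLabelled tl hd c s (insert z U) := by
  classical
  obtain ⟨hs, μ, hμ, hpath⟩ := h
  obtain ⟨b, hbmem, hbmin⟩ := (univ.filter fun a => tl a ∈ U ∧ hd a ∉ U).exists_min_image
    (fun a => c a - (μ (tl a) - μ (hd a))) (by simpa [Finset.Nonempty] using hU)
  simp only [mem_filter, mem_univ, true_and] at hbmem hbmin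
  obtain ⟨hb, hb'⟩ := hbmem
  set ε := c b - (μ (tl b) - μ (hd b)) with hε
  have hε0 : 0 ≤ ε := sub_nonneg.2 (hμ b)
  let ν : N → ℝ := fun i => μ i + if i ∈ U then ε else 0
  have hν (a : A) (h1 : tl a ∈ U) (h2 : hd a ∈ U) :
      ν (tl a) - ν (hd a) = μ (tl a) - μ (hd a) := by
    simp [ν, h1, h2]
  refine ⟨hd b, hb', mem_insert_of_mem hs, ν, fun a => ?_, fun x hx => ?_⟩
  · have h1 := hμ a
    have h2 := hbmin a
    by_cases ht : tl a ∈ U <;> by_cases hh : hd a ∈ U <;> simp only [ν, ht, hh, if_true, if_false]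
    · linarith
    · linarith [h2 ⟨ht, hh⟩]
    · linarith
    · linarith
  · rcases mem_insert.1 hx with rfl | hx
    · obtain ⟨y, hy⟩ := hpath _ hb
      refine ⟨_, (hy.mono (Subset.refl U) hν).extend hb hb' ?_⟩
      simp only [ν, hb, hb', if_true, if_false]
      linarith
    · obtain ⟨y, hy⟩ := hpath x hx
      exact ⟨y, hy.mono (subset_insert _ _) hν⟩

/-- If `f` is reachable from `s`, some feasible potential admits a tight path from `s` to `f`. -/
lemma exists_isTightPath [Fintype N] {tl hd : A → N} {c : A → ℝ} (hc : ∀ a, 0 ≤ c a) {s f : N}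
    (hreach : Relation.ReflTransGen (fun x y => ∃ a, tl a = x ∧ hd a = y) s f) :
    ∃ (μ : N → ℝ) (U : Finset N) (y : A → ℝ), (∀ a, μ (tl a) - μ (hd a) ≤ c a) ∧
      IsTightPath tl hd c μ U s f y := by
  obtain ⟨U, hU, hmax⟩ := (Set.toFinite {U | IsLabelled tl hd c s U}).exists_maximal
    ⟨{s}, isLabelled_singleton hc s⟩
  have hf : f ∈ U := by
    by_contra hf
    obtain ⟨z, hz, hzU⟩ := IsLabelled.exists_insert hU (exists_arc_leaving hreach hU.1 hf)
    exact hz (hmax hzU (subset_insert z U) (mem_insert_self z U))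
  obtain ⟨-, μ, hμ, hpath⟩ := hU
  obtain ⟨y, hy⟩ := hpath f hf
  exact ⟨μ, U, y, hμ, hy⟩

end ShortestPath

/-- (LP duality for the shortest path polytope.)  If `f` is reachable
from `s` and the arc costs `c` are nonnegative, then the minimum cost of a simple
directed `s`–`f` path equals the maximum of `μ_s − μ_f` over node potentials `μ` with
`μ_i − μ_{i'} ≤ c_a` for every arc `a = (i, i')`. -/
theorem shortest_path_LP_duality
    {N A : Type*} [Fintype N] [Fintype A] [DecidableEq N]
    (tl hd : A → N) (s f : N) (hsf : s ≠ f)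
    -- the set of incidence vectors of simple `s`-`f` paths
    (Ypaths : Set (A → ℝ))
    (hY : Ypaths = {y : A → ℝ |
      (∀ a, y a = 0 ∨ y a = 1) ∧
      (∀ i : N, ((∑ a ∈ Finset.univ.filter (fun a => tl a = i), y a)
          - ∑ a ∈ Finset.univ.filter (fun a => hd a = i), y a)
          = if i = s then 1 else if i = f then -1 else 0) ∧
      (∀ i : N, (∑ a ∈ Finset.univ.filter (fun a => tl a = i), y a) ≤ 1)})
    -- `f` is reachable from `s`
    (hreach : Relation.ReflTransGen (fun x y => ∃ a, tl a = x ∧ hd a = y) s f)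
    -- nonnegative arc costs
    (c : A → ℝ) (hc : ∀ a, 0 ≤ c a) :
    ∃ v : ℝ,
      IsLeast {r | ∃ y ∈ Ypaths, r = ∑ a, c a * y a} v ∧
      IsGreatest {r | ∃ μ : N → ℝ,
          (∀ a : A, μ (tl a) - μ (hd a) ≤ c a) ∧ r = μ s - μ f} v := by
  subst hY
  have hweak (μ : N → ℝ) (hμ : ∀ a, μ (tl a) - μ (hd a) ≤ c a) (y : A → ℝ)
      (h01 : ∀ a, y a = 0 ∨ y a = 1)
      (hflow : ∀ i, ShortestPath.netOutflow tl hd y i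
        = if i = s then 1 else if i = f then -1 else 0) :
      μ s - μ f ≤ ∑ a, c a * y a := by
    rw [← ShortestPath.sum_potential_mul_ite hsf μ]
    simp only [← hflow]
    rw [← ShortestPath.sum_potential_diff_mul]
    refine Finset.sum_le_sum fun a _ => mul_le_mul_of_nonneg_right (hμ a) ?_
    rcases h01 a with h | h <;> simp [h]
  obtain ⟨μ, U, y, hμ, hy⟩ := ShortestPath.exists_isTightPath hc hreach
  have hflow (i : N) : ShortestPath.netOutflow tl hd y i
      = if i = s then 1 else if i = f then -1 else 0 := by
    rw [hy.flow]
    by_cases h1 : i = s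
    · subst h1; simp [hsf]
    · by_cases h2 : i = f <;> simp [h1, h2, hsf.symm]
  have hval : μ s - μ f = ∑ a, c a * y a := by
    rw [← ShortestPath.sum_potential_mul_ite hsf μ]
    simp only [← hflow]
    rw [← ShortestPath.sum_potential_diff_mul]
    refine Finset.sum_congr rfl fun a _ => ?_
    by_cases ha : y a = 0
    · simp [ha]
    · rw [hy.tight a ha]
  refine ⟨μ s - μ f, ⟨⟨y, ⟨hy.zero_or_one, hflow, hy.outflow_le⟩, hval⟩, ?_⟩,
    ⟨μ, hμ, rfl⟩, ?_⟩
  · rintro _ ⟨z, ⟨hz, hzflow, -⟩, rfl⟩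
    exact hweak μ hμ z hz hzflow
  · rintro _ ⟨ν, hν, rfl⟩
    exact hval ▸ hweak ν hν y hy.zero_or_one hflow
end

section
/- (LP reformulation of the max–min problem.) Let S₀ = {c̄ ∈ ℝ^A : B₀ c̄ ≤ b₀} be nonempty with every c̄ ∈ S₀ nonnegative, and assume f is reachable from s. Then max_{c̄∈S₀} min_{y∈Y} c̄^⊤ y = max { μ_s − μ_f : (c̄, μ) ∈ ℝ^A × ℝ^N, μ_i − μ_{i'} ≤ c̄_a for every arc a = (i, i') ∈ A, B₀ c̄ ≤ b₀ }; in particular, the max–min value z_lower := max_{Q∈Q} min_{y∈Y} E_Q[c^⊤ y], which under Assumptions A4 and A5 equals max_{c̄∈S₀} min_{y∈Y} c̄^⊤ y, is the optimal value of a single linear program. -/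
open MeasureTheory

/-- `IsArcWalk tl hd i l j` says that the arcs of `l` form a directed walk from `i` to `j`. -/
def IsArcWalk {N A : Type*} (tl hd : A → N) : N → List A → N → Prop
  | i, [], j => i = j
  | i, a :: l, j => tl a = i ∧ IsArcWalk tl hd (hd a) l j

theorem IsArcWalk.exists_of_reflTransGen {N A : Type*} {tl hd : A → N} {i j : N}
    (h : Relation.ReflTransGen (fun x y => ∃ a, tl a = x ∧ hd a = y) i j) :
    ∃ l, IsArcWalk tl hd i l j := by
  induction h using Relation.ReflTransGen.head_induction_on with
  | refl => exact ⟨[], rfl⟩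
  | head h _ ih =>
    obtain ⟨a, rfl, rfl⟩ := h
    obtain ⟨l, hl⟩ := ih
    exact ⟨a :: l, rfl, hl⟩

theorem IsArcWalk.exists_suffix {N A : Type*} {tl hd : A → N} {i j f : N} {l : List A}
    (h : IsArcWalk tl hd j l f) (hi : i ∈ l.map tl) :
    ∃ l', IsArcWalk tl hd i l' f ∧ l'.Sublist l := by
  induction l generalizing j with
  | nil => simp at hi
  | cons a l ih =>
    by_cases hia : tl a = i
    · exact ⟨a :: l, ⟨hia, h.2⟩, List.Sublist.refl _⟩
    · have hi' : i ∈ l.map tl := by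
        rw [List.map_cons, List.mem_cons] at hi
        exact hi.resolve_left (fun h => hia h.symm)
      obtain ⟨l', h₁, h₂⟩ := ih h.2 hi'
      exact ⟨l', h₁, h₂.cons a⟩

/-- Every walk contains a walk with the same endpoints that leaves each node at most once. -/
theorem IsArcWalk.exists_simple {N A : Type*} {tl hd : A → N} {i f : N} {l : List A}
    (h : IsArcWalk tl hd i l f) :
    ∃ l', IsArcWalk tl hd i l' f ∧ (l'.map tl).Nodup ∧ l'.Sublist l := by
  induction l generalizing i with
  | nil => exact ⟨[], h, by simp, List.Sublist.refl _⟩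
  | cons a l ih =>
    obtain ⟨l', h₁, h₂, h₃⟩ := ih h.2
    by_cases hi : i ∈ l'.map tl
    · obtain ⟨l'', h₄, h₅⟩ := h₁.exists_suffix hi
      exact ⟨l'', h₄, h₂.sublist (h₅.map tl), (h₅.trans h₃).cons a⟩
    · refine ⟨a :: l', ⟨h.1, h₁⟩, ?_, h₃.cons_cons a⟩
      rw [List.map_cons, List.nodup_cons, h.1]
      exact ⟨hi, h₂⟩

theorem IsArcWalk.count_tail_sub_count_head {N A : Type*} [DecidableEq N] {tl hd : A → N}
    {i f : N} {l : List A} (h : IsArcWalk tl hd i l f) (v : N) :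
    ((l.map tl).count v : ℝ) - (l.map hd).count v
      = (if v = i then 1 else 0) - (if v = f then 1 else 0) := by
  induction l generalizing i with
  | nil =>
    obtain rfl : i = f := h
    simp
  | cons a l ih =>
    obtain ⟨rfl, h⟩ := h
    have := ih h
    simp only [List.map_cons, List.count_cons, beq_iff_eq, Nat.cast_add, Nat.cast_ite,
      Nat.cast_one, Nat.cast_zero, eq_comm (b := v)]
    linarith

theorem sum_mul_count_eq_sum_map {A : Type*} [Fintype A] [DecidableEq A] (c : A → ℝ)
    (l : List A) : ∑ a, c a * (l.count a : ℝ) = (l.map c).sum := by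
  induction l with
  | nil => simp
  | cons a l ih =>
    simp [List.count_cons, mul_add, Finset.sum_add_distrib, ih, add_comm]

theorem sum_filter_count_eq_count_map {N A : Type*} [Fintype A] [DecidableEq A]
    [DecidableEq N] (g : A → N) (l : List A) (i : N) :
    ∑ a ∈ Finset.univ.filter (fun a => g a = i), (l.count a : ℝ) = (l.map g).count i := by
  induction l with
  | nil => simp
  | cons a l ih =>
    simp [List.count_cons, Finset.sum_add_distrib, ih]

/-- The 0-1 vectors obeying flow conservation from `s` to `f` and leaving each node at most
once. -/
def pathVectors {N A : Type*} [Fintype A] [DecidableEq N] (tl hd : A → N) (s f : N) :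
    Set (A → ℝ) :=
  {y : A → ℝ |
    (∀ a, y a = 0 ∨ y a = 1) ∧
    (∀ i : N, ((∑ a ∈ Finset.univ.filter (fun a => tl a = i), y a)
        - ∑ a ∈ Finset.univ.filter (fun a => hd a = i), y a)
        = if i = s then 1 else if i = f then -1 else 0) ∧
    (∀ i : N, (∑ a ∈ Finset.univ.filter (fun a => tl a = i), y a) ≤ 1)}

theorem IsArcWalk.exists_mem_pathVectors {N A : Type*} [Fintype A] [DecidableEq N]
    {tl hd : A → N} {s f : N} (hsf : s ≠ f) {l : List A} (h : IsArcWalk tl hd s l f)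
    {c : A → ℝ} (hc : ∀ a, 0 ≤ c a) :
    ∃ y ∈ pathVectors tl hd s f, ∑ a, c a * y a ≤ (l.map c).sum := by
  classical
  obtain ⟨l', h₁, h₂, h₃⟩ := h.exists_simple
  refine ⟨fun a => (l'.count a : ℝ), ⟨fun a => ?_, fun i => ?_, fun i => ?_⟩, ?_⟩
  · have := List.nodup_iff_count_le_one.1 (List.Nodup.of_map tl h₂) a
    rcases Nat.le_one_iff_eq_zero_or_eq_one.1 this with h | h <;> simp [h]
  · rw [sum_filter_count_eq_count_map, sum_filter_count_eq_count_map,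
      h₁.count_tail_sub_count_head]
    by_cases hs : i = s
    · simp [hs, hsf]
    · by_cases hf : i = f <;> simp [hs, hf, hsf.symm]
  · rw [sum_filter_count_eq_count_map]
    exact_mod_cast List.nodup_iff_count_le_one.1 h₂ i
  · rw [sum_mul_count_eq_sum_map]
    refine (h₃.map c).sum_le_sum fun x hx => ?_
    obtain ⟨a, -, rfl⟩ := List.mem_map.1 hx
    exact hc a

theorem finite_pathVectors {N A : Type*} [Fintype A] [DecidableEq N] (tl hd : A → N)
    (s f : N) : (pathVectors tl hd s f).Finite := by
  refine (Set.Finite.pi' (t := fun _ : A => ({0, 1} : Set ℝ))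
    (fun _ => Set.toFinite _)).subset fun y hy a => ?_
  simpa using hy.1 a

/-- Weak duality between potentials and path vectors. -/
theorem potential_sub_le_of_mem_pathVectors {N A : Type*} [Fintype N] [Fintype A]
    [DecidableEq N] {tl hd : A → N} {s f : N} (hsf : s ≠ f) {y : A → ℝ}
    (hy : y ∈ pathVectors tl hd s f) {c : A → ℝ} {μ : N → ℝ}
    (hμ : ∀ a, μ (tl a) - μ (hd a) ≤ c a) : μ s - μ f ≤ ∑ a, c a * y a := by
  obtain ⟨h₁, h₂, -⟩ := hy
  have hfib : ∀ g : A → N, ∑ a, μ (g a) * y a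
      = ∑ i, μ i * ∑ a ∈ Finset.univ.filter (fun a => g a = i), y a := by
    intro g
    rw [← Finset.sum_fiberwise Finset.univ g]
    refine Finset.sum_congr rfl fun i _ => ?_
    rw [Finset.mul_sum]
    refine Finset.sum_congr rfl fun a ha => ?_
    rw [(Finset.mem_filter.1 ha).2]
  have hflow : μ s - μ f = ∑ a, (μ (tl a) - μ (hd a)) * y a := by
    simp_rw [sub_mul]
    rw [Finset.sum_sub_distrib, hfib tl, hfib hd, ← Finset.sum_sub_distrib]
    simp_rw [← mul_sub, h₂]
    have : ∀ i, μ i * (if i = s then (1 : ℝ) else if i = f then -1 else 0)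
        = (if i = s then μ i else 0) - (if i = f then μ i else 0) := by
      intro i
      by_cases hs : i = s
      · simp [hs, hsf]
      · by_cases hf : i = f <;> simp [hs, hf, hsf.symm]
    simp [this, Finset.sum_sub_distrib]
  rw [hflow]
  refine Finset.sum_le_sum fun a _ => mul_le_mul_of_nonneg_right (hμ a) ?_
  rcases h₁ a with h | h <;> simp [h]

/-- Strong duality: truncated shortest walk distances to `f` form a potential whose drop
from `s` to `f` is at least any lower bound `M` on the costs of path vectors. -/
theorem exists_potential_of_le_pathVectors {N A : Type*} [Fintype A] [DecidableEq N]
    {tl hd : A → N} {s f : N} (hsf : s ≠ f) {c : A → ℝ} (hc : ∀ a, 0 ≤ c a) {M : ℝ}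
    (hM₀ : 0 ≤ M) (hM : ∀ y ∈ pathVectors tl hd s f, M ≤ ∑ a, c a * y a) :
    ∃ μ : N → ℝ, (∀ a, μ (tl a) - μ (hd a) ≤ c a) ∧ M ≤ μ s - μ f := by
  let W : N → Set ℝ := fun i => insert M {w | ∃ l, IsArcWalk tl hd i l f ∧ w = (l.map c).sum}
  have hWne : ∀ i, (W i).Nonempty := fun i => Set.insert_nonempty _ _
  have hWbdd : ∀ i, BddBelow (W i) := by
    refine fun i => ⟨0, ?_⟩
    rintro w (rfl | ⟨l, -, rfl⟩)
    · exact hM₀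
    · refine List.sum_nonneg fun x hx => ?_
      obtain ⟨a, -, rfl⟩ := List.mem_map.1 hx
      exact hc a
  refine ⟨fun i => sInf (W i), fun a => ?_, ?_⟩
  · rw [sub_le_comm]
    refine le_csInf (hWne _) ?_
    rintro w (rfl | ⟨l, hl, rfl⟩)
    · linarith [csInf_le (hWbdd (tl a)) (Set.mem_insert w _), hc a]
    · have : sInf (W (tl a)) ≤ ((a :: l).map c).sum :=
        csInf_le (hWbdd _) (Or.inr ⟨a :: l, ⟨rfl, hl⟩, rfl⟩)
      rw [List.map_cons, List.sum_cons] at this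
      linarith
  · have hf : sInf (W f) ≤ 0 := csInf_le (hWbdd f) (Or.inr ⟨[], rfl, by simp⟩)
    have hs : M ≤ sInf (W s) := by
      refine le_csInf (hWne s) ?_
      rintro w (rfl | ⟨l, hl, rfl⟩)
      · exact le_rfl
      · obtain ⟨y, hy, hle⟩ := hl.exists_mem_pathVectors hsf hc
        exact (hM y hy).trans hle
    linarith

theorem continuous_sInf_sum_mul {A : Type*} [Fintype A] {Y : Set (A → ℝ)} (hY : Y.Finite)
    (hne : Y.Nonempty) :
    Continuous fun c : A → ℝ => sInf {w | ∃ y ∈ Y, w = ∑ a, c a * y a} := by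
  have hne' : hY.toFinset.Nonempty := by simpa using hne
  have : (fun c : A → ℝ => sInf {w | ∃ y ∈ Y, w = ∑ a, c a * y a})
      = fun c => hY.toFinset.inf' hne' fun y => ∑ a, c a * y a := by
    funext c
    rw [Finset.inf'_eq_csInf_image]
    congr 1
    ext w
    simp [eq_comm]
  rw [this]
  exact Continuous.finset_inf'_apply hne' fun y _ => by fun_prop

theorem integrable_id_of_measure_Icc_eq_one {μ : Measure ℝ} [IsProbabilityMeasure μ]
    {l u : ℝ} (h : (μ (Set.Icc l u)).toReal = 1) : Integrable (fun x => x) μ := by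
  have h1 : μ (Set.Icc l u) = 1 := by
    rw [← ENNReal.toReal_eq_one_iff]
    exact h
  exact Integrable.of_mem_Icc l u aemeasurable_id
    ((mem_ae_iff_prob_eq_one measurableSet_Icc).2 h1)

/-- A mixture of two distributions interpolates all event probabilities and the mean. -/
theorem exists_mixture {μ ν : Measure ℝ} [IsProbabilityMeasure μ] [IsProbabilityMeasure ν]
    (hμ : Integrable (fun x => x) μ) (hν : Integrable (fun x => x) ν) {p q : ℝ}
    (hp : 0 ≤ p) (hq : 0 ≤ q) (hpq : p + q = 1) :
    ∃ ρ : Measure ℝ, IsProbabilityMeasure ρ ∧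
      (∀ E, (ρ E).toReal = p * (μ E).toReal + q * (ν E).toReal) ∧
      ∫ x, x ∂ρ = p * ∫ x, x ∂μ + q * ∫ x, x ∂ν := by
  refine ⟨ENNReal.ofReal p • μ + ENNReal.ofReal q • ν, ⟨?_⟩, fun E => ?_, ?_⟩
  · simp [← ENNReal.ofReal_add hp hq, hpq]
  · simp only [Measure.coe_add, Measure.coe_smul, Pi.add_apply, Pi.smul_apply, smul_eq_mul]
    rw [ENNReal.toReal_add (ENNReal.mul_ne_top ENNReal.ofReal_ne_top (measure_ne_top _ _))
      (ENNReal.mul_ne_top ENNReal.ofReal_ne_top (measure_ne_top _ _)), ENNReal.toReal_mul,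
      ENNReal.toReal_mul, ENNReal.toReal_ofReal hp, ENNReal.toReal_ofReal hq]
  · rw [integral_add_measure (hμ.smul_measure ENNReal.ofReal_ne_top)
      (hν.smul_measure ENNReal.ofReal_ne_top), integral_smul_measure, integral_smul_measure,
      ENNReal.toReal_ofReal hp, ENNReal.toReal_ofReal hq, smul_eq_mul, smul_eq_mul]

/-- (LP reformulation of the max–min problem.)  With `S₀` nonempty
and consisting of nonnegative cost vectors, and `f` reachable from `s`,
`max_{c̄∈S₀} min_{y∈Y} c̄ᵀy` equals the optimal value of the linear program
`max {μ_s − μ_f : μ_i − μ_{i'} ≤ c̄_a ∀a, c̄ ∈ S₀}`; in particular the max–min value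
`z_lower = max_{Q∈Q} min_{y∈Y} E_Q[cᵀy]`, which under Assumptions A4 and A5 equals
`max_{c̄∈S₀} min_{y∈Y} c̄ᵀy`, is the optimal value of a single linear program. -/
theorem maxmin_LP_reformulation
    {N A : Type*} [Fintype N] [Fintype A] [DecidableEq N]
    (tl hd : A → N) (s f : N) (hsf : s ≠ f)
    -- the set of incidence vectors of simple `s`-`f` paths
    (Ypaths : Set (A → ℝ))
    (hY : Ypaths = {y : A → ℝ |
      (∀ a, y a = 0 ∨ y a = 1) ∧
      (∀ i : N, ((∑ a ∈ Finset.univ.filter (fun a => tl a = i), y a)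
          - ∑ a ∈ Finset.univ.filter (fun a => hd a = i), y a)
          = if i = s then 1 else if i = f then -1 else 0) ∧
      (∀ i : N, (∑ a ∈ Finset.univ.filter (fun a => tl a = i), y a) ≤ 1)})
    -- `f` is reachable from `s`
    (hreach : Relation.ReflTransGen (fun x y => ∃ a, tl a = x ∧ hd a = y) s f)
    -- data of the linear expectation constraints
    {k : ℕ} (B : Fin k → A → ℝ) (b : Fin k → ℝ)
    -- data of the individual probability constraints
    (d : A → ℕ) (hd0 : ∀ a, 0 < d a)
    (l u : (a : A) → Fin (d a) → ℝ)
    (qlo qhi : (a : A) → Fin (d a) → ℝ)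
    (hsupp0 : ∀ a, 0 ≤ l a ⟨0, hd0 a⟩)
    (hsupp1 : ∀ a, l a ⟨0, hd0 a⟩ ≤ u a ⟨0, hd0 a⟩)
    (hsuppq : ∀ a, qlo a ⟨0, hd0 a⟩ = 1 ∧ qhi a ⟨0, hd0 a⟩ = 1)
    (hsub : ∀ a j, Set.Icc (l a j) (u a j) ⊆ Set.Icc (l a ⟨0, hd0 a⟩) (u a ⟨0, hd0 a⟩))
    -- the one-dimensional ambiguity sets `Q̃_a`
    (Qtilde : (a : A) → Set (Measure ℝ))
    (hQtilde : ∀ a, Qtilde a = {μ | IsProbabilityMeasure μ ∧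
        ∀ j, (μ (Set.Icc (l a j) (u a j))).toReal ∈ Set.Icc (qlo a j) (qhi a j)})
    -- the ambiguity set `Q`
    (Amb : Set (Measure (A → ℝ)))
    (hAmb : Amb = {Q | IsProbabilityMeasure Q ∧
        (∀ i : Fin k, (∫ c, (∑ a, B i a * c a) ∂Q) ≤ b i) ∧
        (∀ a, Measure.map (fun c => c a) Q ∈ Qtilde a)})
    -- `L_a` and `U_a` are the minimal and maximal achievable means of arc `a`
    (L U : A → ℝ)
    (hL : ∀ a, IsLeast {m | ∃ μ ∈ Qtilde a, m = ∫ x, x ∂μ} (L a))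
    (hU : ∀ a, IsGreatest {m | ∃ μ ∈ Qtilde a, m = ∫ x, x ∂μ} (U a))
    -- the polyhedron `S₀` of expected cost vectors
    (S0 : Set (A → ℝ))
    (hS0 : S0 = {cbar : A → ℝ | (∀ a, L a ≤ cbar a ∧ cbar a ≤ U a) ∧
        ∀ i : Fin k, (∑ a, B i a * cbar a) ≤ b i})
    (hS0ne : S0.Nonempty)
    (hS0pos : ∀ cbar ∈ S0, ∀ a, 0 ≤ cbar a)
    -- Assumption A4
    (hA4 : ∀ a, ∃ μ ∈ Qtilde a, ∀ j, qlo a j < qhi a j →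
        (μ (Set.Icc (l a j) (u a j))).toReal ∈ Set.Ioo (qlo a j) (qhi a j))
    -- Assumption A5
    (hA5 : ∀ a, ∀ j₁ j₂ : Fin (d a), j₁ ≠ j₂ → l a j₁ ≠ u a j₂) :
    ∃ v : ℝ,
      -- `max_{c̄∈S₀} min_{y∈Y} c̄ᵀy = v`
      IsGreatest {r | ∃ cbar ∈ S0, r = sInf {w | ∃ y ∈ Ypaths, w = ∑ a, cbar a * y a}} v ∧
      -- `v` is the optimal value of the single linear program
      IsGreatest {r | ∃ cbar : A → ℝ, ∃ μ : N → ℝ, cbar ∈ S0 ∧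
          (∀ a : A, μ (tl a) - μ (hd a) ≤ cbar a) ∧ r = μ s - μ f} v ∧
      -- and `z_lower = max_{Q∈Q} min_{y∈Y} E_Q[cᵀy] = v`
      sSup {r | ∃ Q ∈ Amb, r =
          sInf {w | ∃ y ∈ Ypaths, w = ∫ c, (∑ a, c a * y a) ∂Q}} = v := by
  have hint : ∀ a, ∀ μ ∈ Qtilde a, Integrable (fun x => x) μ := by
    intro a μ hμ
    rw [hQtilde] at hμ
    obtain ⟨hprob, hμ⟩ := hμ
    have h := hμ ⟨0, hd0 a⟩
    rw [(hsuppq a).1, (hsuppq a).2, Set.Icc_self] at h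
    exact integrable_id_of_measure_Icc_eq_one h
  -- every mean in `[L a, U a]` is achieved by a mixture of the extremal marginals
  have hmean : ∀ a m, L a ≤ m → m ≤ U a → ∃ μ ∈ Qtilde a, ∫ x, x ∂μ = m := by
    intro a m h₁ h₂
    obtain ⟨μ, hμ, hLμ⟩ := (hL a).1
    obtain ⟨ν, hν, hUν⟩ := (hU a).1
    have hm : m ∈ segment ℝ (L a) (U a) := by
      rw [segment_eq_Icc (h₁.trans h₂)]
      exact ⟨h₁, h₂⟩
    obtain ⟨p, q, hp, hq, hpq, hpqm⟩ := hm
    have hiμ := hint a μ hμ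
    have hiν := hint a ν hν
    rw [hQtilde] at hμ hν
    obtain ⟨hprobμ, hμ⟩ := hμ
    obtain ⟨hprobν, hν⟩ := hν
    obtain ⟨ρ, hρ, hE, hmρ⟩ := exists_mixture hiμ hiν hp hq hpq
    refine ⟨ρ, ?_, ?_⟩
    · rw [hQtilde]
      refine ⟨hρ, fun j => ?_⟩
      rw [hE]
      exact convex_Icc (qlo a j) (qhi a j) (hμ j) (hν j) hp hq hpq
    · rw [hmρ, ← hLμ, ← hUν, ← hpqm, smul_eq_mul, smul_eq_mul]
  have hQint : ∀ Q : Measure (A → ℝ), (∀ a, Measure.map (fun c => c a) Q ∈ Qtilde a) →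
      ∀ a, Integrable (fun c => c a) Q := fun Q hQ a =>
    (integrable_map_measure aestronglyMeasurable_id
      (measurable_pi_apply a).aemeasurable).1 (hint a _ (hQ a))
  have hQmean : ∀ (Q : Measure (A → ℝ)) (a : A),
      ∫ x, x ∂(Measure.map (fun c => c a) Q) = ∫ c, c a ∂Q := fun Q a =>
    integral_map (measurable_pi_apply a).aemeasurable aestronglyMeasurable_id
  have hQlin : ∀ Q : Measure (A → ℝ), (∀ a, Measure.map (fun c => c a) Q ∈ Qtilde a) →
      ∀ w : A → ℝ, ∫ c, (∑ a, c a * w a) ∂Q = ∑ a, (∫ c, c a ∂Q) * w a := by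
    intro Q hQ w
    rw [integral_finsetSum _ fun a _ => (hQint Q hQ a).mul_const _]
    simp_rw [integral_mul_const]
  -- the mean vectors of the distributions in `Amb` are exactly the members of `S0`
  have hAmbS0 : ∀ Q ∈ Amb, (fun a => ∫ c, c a ∂Q) ∈ S0 := by
    intro Q hQ
    rw [hAmb] at hQ
    obtain ⟨-, hB, hQ⟩ := hQ
    rw [hS0]
    refine ⟨fun a => ⟨(hL a).2 ⟨_, hQ a, (hQmean Q a).symm⟩,
      (hU a).2 ⟨_, hQ a, (hQmean Q a).symm⟩⟩, fun i => ?_⟩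
    have := hB i
    simp_rw [mul_comm (B i _)] at this ⊢
    rwa [hQlin Q hQ] at this
  have hS0Amb : ∀ c ∈ S0, ∃ Q ∈ Amb, ∀ a, ∫ x, x a ∂Q = c a := by
    intro c hc
    rw [hS0] at hc
    choose μ hμ hμm using fun a => hmean a (c a) (hc.1 a).1 (hc.1 a).2
    have hprob : ∀ a, IsProbabilityMeasure (μ a) := fun a => by
      have := hμ a
      rw [hQtilde] at this
      exact this.1
    have hmap : ∀ a, Measure.map (fun x => x a) (Measure.pi μ) = μ a := fun a =>
      (measurePreserving_eval μ a).map_eq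
    have hmem : ∀ a, Measure.map (fun x => x a) (Measure.pi μ) ∈ Qtilde a := fun a => by
      rw [hmap]
      exact hμ a
    have hcoord : ∀ a, ∫ x, x a ∂(Measure.pi μ) = c a := fun a => by
      rw [← hQmean, hmap, hμm]
    refine ⟨Measure.pi μ, ?_, hcoord⟩
    rw [hAmb]
    refine ⟨inferInstance, fun i => ?_, hmem⟩
    have := hc.2 i
    simp_rw [mul_comm (B i _)] at this ⊢
    rw [hQlin _ hmem]
    simpa only [hcoord] using this
  have hY' : Ypaths = pathVectors tl hd s f := hY
  obtain ⟨l₀, hl₀⟩ := IsArcWalk.exists_of_reflTransGen hreach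
  have hYne : Ypaths.Nonempty := by
    obtain ⟨y, hy, -⟩ := hl₀.exists_mem_pathVectors hsf (c := fun _ => 0) (fun _ => le_rfl)
    exact ⟨y, hY' ▸ hy⟩
  have hYfin : Ypaths.Finite := hY' ▸ finite_pathVectors tl hd s f
  have hvalne : ∀ c : A → ℝ, {w | ∃ y ∈ Ypaths, w = ∑ a, c a * y a}.Nonempty := fun c =>
    let ⟨y, hy⟩ := hYne
    ⟨_, y, hy, rfl⟩
  have hval₀ : ∀ c ∈ S0, ∀ w ∈ {w | ∃ y ∈ Ypaths, w = ∑ a, c a * y a}, 0 ≤ w := by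
    rintro c hc w ⟨y, hy, rfl⟩
    rw [hY'] at hy
    refine Finset.sum_nonneg fun a _ => mul_nonneg (hS0pos c hc a) ?_
    rcases hy.1 a with h | h <;> simp [h]
  have hcompact : IsCompact S0 := by
    have : S0 = Set.Icc L U ∩ {c | ∀ i : Fin k, (∑ a, B i a * c a) ≤ b i} := by
      rw [hS0]
      ext c
      simp [Pi.le_def, forall_and]
    rw [this]
    refine isCompact_Icc.inter_right ?_
    rw [Set.ofPred_forall]
    exact isClosed_iInter fun i => isClosed_le (by fun_prop) continuous_const
  obtain ⟨c, hc, hmax⟩ := hcompact.exists_isMaxOn hS0ne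
    (continuous_sInf_sum_mul hYfin hYne).continuousOn
  have hgreatest : IsGreatest {r | ∃ cbar ∈ S0,
      r = sInf {w | ∃ y ∈ Ypaths, w = ∑ a, cbar a * y a}}
      (sInf {w | ∃ y ∈ Ypaths, w = ∑ a, c a * y a}) := by
    refine ⟨⟨c, hc, rfl⟩, ?_⟩
    rintro r ⟨c', hc', rfl⟩
    exact hmax hc'
  have hweak : ∀ (c' : A → ℝ) (μ : N → ℝ), (∀ a, μ (tl a) - μ (hd a) ≤ c' a) →
      μ s - μ f ≤ sInf {w | ∃ y ∈ Ypaths, w = ∑ a, c' a * y a} := by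
    refine fun c' μ hμ => le_csInf (hvalne c') ?_
    rintro w ⟨y, hy, rfl⟩
    exact potential_sub_le_of_mem_pathVectors hsf (hY' ▸ hy) hμ
  refine ⟨_, hgreatest, ⟨?_, ?_⟩, ?_⟩
  · obtain ⟨μ, hμ, hle⟩ := exists_potential_of_le_pathVectors (tl := tl) (hd := hd) hsf
      (hS0pos c hc) (le_csInf (hvalne c) (hval₀ c hc))
      fun y hy => csInf_le ⟨0, hval₀ c hc⟩ ⟨y, hY' ▸ hy, rfl⟩
    exact ⟨c, μ, hc, hμ, le_antisymm hle (hweak c μ hμ)⟩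
  · rintro r ⟨c', μ, hc', hμ, rfl⟩
    exact (hweak c' μ hμ).trans (hmax hc')
  · rw [← hgreatest.csSup_eq]
    congr 1
    have hAmb' : ∀ Q ∈ Amb, ∀ a, Measure.map (fun c => c a) Q ∈ Qtilde a := fun Q hQ => by
      rw [hAmb] at hQ
      exact hQ.2.2
    ext r
    constructor
    · rintro ⟨Q, hQ, rfl⟩
      refine ⟨_, hAmbS0 Q hQ, ?_⟩
      simp_rw [hQlin Q (hAmb' Q hQ)]
    · rintro ⟨c', hc', rfl⟩
      obtain ⟨Q, hQ, hQc⟩ := hS0Amb c' hc'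
      refine ⟨Q, hQ, ?_⟩
      simp_rw [hQlin Q (hAmb' Q hQ), hQc]
end

section
/- Consider the directed graph with node set {1,…,8}, arcs (1,2),(1,3),(2,4),(2,5),(3,6),(3,7),(4,8),(5,8),(6,8),(7,8), source s = 1 and destination f = 8, and let A' = {(2,4),(2,5),(3,6),(3,7)}. Let Q be the set of Borel probability distributions Q of c ∈ ℝ^A with Q(c_a = 0) = 1 for every arc a ∉ A', Q(c_a ∈ [0,1]) = 1 for every a ∈ A', and E_Q[Σ_{a∈A'} c_a] ≤ 1. Then min_{y∈Y} max_{Q∈Q} E_Q[c^⊤ y] = 1 and max_{Q∈Q} min_{y∈Y} E_Q[c^⊤ y] = 1/4. -/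
open MeasureTheory

/-- Tails of the ten arcs `(1,2),(1,3),(2,4),(2,5),(3,6),(3,7),(4,8),(5,8),(6,8),(7,8)`. -/
def tails : Fin 10 → ℕ := ![1, 1, 2, 2, 3, 3, 4, 5, 6, 7]

/-- Heads of the ten arcs. -/
def heads : Fin 10 → ℕ := ![2, 3, 4, 5, 6, 7, 8, 8, 8, 8]

/-- The arcs `(2,4),(2,5),(3,6),(3,7)`. -/
def Aprime : Finset (Fin 10) := {2, 3, 4, 5}

/-- Incidence vectors of simple `1`–`8` paths in the example network. -/
def Yex : Set (Fin 10 → ℝ) :=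
  {y | (∀ a, y a = 0 ∨ y a = 1) ∧
    (∀ i : ℕ, ((∑ a ∈ Finset.univ.filter (fun a => tails a = i), y a)
        - ∑ a ∈ Finset.univ.filter (fun a => heads a = i), y a)
        = if i = 1 then 1 else if i = 8 then -1 else 0) ∧
    (∀ i : ℕ, (∑ a ∈ Finset.univ.filter (fun a => tails a = i), y a) ≤ 1)}

/-- The ambiguity set of Example 1: arcs outside `A'` cost `0` a.s., arcs in `A'` are
supported on `[0,1]`, and the total expected cost over `A'` is at most `1`. -/
def AmbEx : Set (Measure (Fin 10 → ℝ)) :=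
  {Q | IsProbabilityMeasure Q ∧
    (∀ a ∉ Aprime, Q {c | c a = 0} = 1) ∧
    (∀ a ∈ Aprime, Q {c | c a ∈ Set.Icc (0 : ℝ) 1} = 1) ∧
    (∫ c, (∑ a ∈ Aprime, c a) ∂Q) ≤ 1}

lemma sum_Aprime {M : Type*} [AddCommMonoid M] (g : Fin 10 → M) :
    ∑ a ∈ Aprime, g a = g 2 + (g 3 + (g 4 + g 5)) := by
  simp [Aprime]

lemma sum_fin_ten {M : Type*} [AddCommMonoid M] (g : Fin 10 → M) :
    ∑ a, g a = g 0 + g 1 + g 2 + g 3 + g 4 + g 5 + g 6 + g 7 + g 8 + g 9 := by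
  rw [Fin.sum_univ_castSucc, Fin.sum_univ_castSucc, Fin.sum_univ_eight]
  rfl

/-- Every path uses exactly one arc of `Aprime`. -/
lemma sum_Aprime_of_mem_Yex {y : Fin 10 → ℝ} (hy : y ∈ Yex) : ∑ a ∈ Aprime, y a = 1 := by
  obtain ⟨-, hflow, -⟩ := hy
  have h1 := hflow 1
  have h2 := hflow 2
  have h3 := hflow 3
  simp only [Finset.sum_filter, sum_fin_ten] at h1 h2 h3
  simp [tails, heads] at h1 h2 h3
  rw [sum_Aprime]
  linarith

/-- Flow conservation at the nodes `1,…,7`, written out, suffices for membership in `Y`. -/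
lemma mem_Yex_of_flow {y : Fin 10 → ℝ} (h01 : ∀ a, y a = 0 ∨ y a = 1) (h1 : y 0 + y 1 = 1)
    (h2 : y 2 + y 3 = y 0) (h3 : y 4 + y 5 = y 1) (h4 : y 6 = y 2) (h5 : y 7 = y 3)
    (h6 : y 8 = y 4) (h7 : y 9 = y 5) : y ∈ Yex := by
  have ht (i : ℕ) (hi : 9 ≤ i) : Finset.univ.filter (fun a => tails a = i) = ∅ := by
    have : ∀ a, tails a < 9 := by decide
    exact Finset.filter_eq_empty_iff.2 fun a _ => ((this a).trans_le hi).ne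
  have hh (i : ℕ) (hi : 9 ≤ i) : Finset.univ.filter (fun a => heads a = i) = ∅ := by
    have : ∀ a, heads a < 9 := by decide
    exact Finset.filter_eq_empty_iff.2 fun a _ => ((this a).trans_le hi).ne
  have hle (a : Fin 10) : y a ≤ 1 := by rcases h01 a with h | h <;> simp [h]
  refine ⟨h01, fun i => ?_, fun i => ?_⟩ <;> rcases lt_or_ge i 9 with hi | hi
  · simp only [Finset.sum_filter, sum_fin_ten]
    interval_cases i <;> simp [tails, heads] <;> linarith
  · rw [ht i hi, hh i hi, if_neg (by omega), if_neg (by omega)]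
    simp
  · simp only [Finset.sum_filter, sum_fin_ten]
    interval_cases i <;> simp [tails, hle] <;> linarith [hle 0, hle 1]
  · simp [ht i hi]

/-- Every arc of `Aprime` is the only arc of `Aprime` on some path. -/
lemma exists_mem_Yex_of_mem_Aprime {k : Fin 10} (hk : k ∈ Aprime) :
    ∃ y ∈ Yex, ∀ a ∈ Aprime, y a = if a = k then 1 else 0 := by
  let p (j : Fin 10) : ℝ := if j = k then 1 else 0
  refine ⟨![p 2 + p 3, p 4 + p 5, p 2, p 3, p 4, p 5, p 2, p 3, p 4, p 5],
    mem_Yex_of_flow ?_ ?_ rfl rfl rfl rfl rfl rfl, ?_⟩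
  · simp only [Aprime, Finset.mem_insert, Finset.mem_singleton] at hk
    intro a
    rcases hk with rfl | rfl | rfl | rfl <;> fin_cases a <;> simp [p]
  · simp only [Aprime, Finset.mem_insert, Finset.mem_singleton] at hk
    rcases hk with rfl | rfl | rfl | rfl <;> simp [p]
  · simp [Aprime, p]

lemma Yex_nonempty : Yex.Nonempty :=
  let ⟨y, hy, _⟩ := exists_mem_Yex_of_mem_Aprime (k := 2) (by decide)
  ⟨y, hy⟩

/-- The expected cost of `y` depends on `Q` only through the means of the arcs of `Aprime`, which are
nonnegative and sum to at most `1`. -/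
lemma exists_mean_of_mem_AmbEx {Q : Measure (Fin 10 → ℝ)} (hQ : Q ∈ AmbEx) :
    ∃ m : Fin 10 → ℝ, (∀ a, 0 ≤ m a) ∧ ∑ a ∈ Aprime, m a ≤ 1 ∧
      ∀ y : Fin 10 → ℝ, ∫ c, (∑ a, c a * y a) ∂Q = ∑ a ∈ Aprime, m a * y a := by
  obtain ⟨hprob, hzero, hIcc, hsum⟩ := hQ
  have hmeas (a : Fin 10) : Measurable fun c : Fin 10 → ℝ => c a := measurable_pi_apply a
  have hae0 : ∀ a ∉ Aprime, ∀ᵐ c ∂Q, c a = 0 := fun a ha =>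
    (mem_ae_iff_prob_eq_one (hmeas a (measurableSet_singleton 0))).2 (hzero a ha)
  have hae1 : ∀ a, ∀ᵐ c ∂Q, c a ∈ Set.Icc (0 : ℝ) 1 := fun a => by
    by_cases ha : a ∈ Aprime
    · exact (mem_ae_iff_prob_eq_one (hmeas a measurableSet_Icc)).2 (hIcc a ha)
    · filter_upwards [hae0 a ha] with c hc
      simp [hc]
  have hint (a : Fin 10) : Integrable (fun c : Fin 10 → ℝ => c a) Q := by
    refine Integrable.of_bound (hmeas a).aestronglyMeasurable 1 ?_
    filter_upwards [hae1 a] with c hc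
    rw [Real.norm_eq_abs, abs_of_nonneg hc.1]
    exact hc.2
  refine ⟨fun a => ∫ c, c a ∂Q, fun a => ?_, ?_, fun y => ?_⟩
  · exact integral_nonneg_of_ae ((hae1 a).mono fun c hc => hc.1)
  · rwa [integral_finsetSum _ fun a _ => hint a] at hsum
  · rw [integral_finsetSum _ fun a _ => (hint a).mul_const _]
    simp only [integral_mul_const]
    refine (Finset.sum_subset (Finset.subset_univ _) fun a _ ha => ?_).symm
    rw [integral_eq_zero_of_ae (hae0 a ha), zero_mul]

/-- Deterministic costs `w` on the arcs of `Aprime`, with total at most `1`, are admissible. -/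
lemma exists_mem_AmbEx_of_costs (w : Fin 10 → ℝ) (hw : ∀ a ∈ Aprime, w a ∈ Set.Icc (0 : ℝ) 1)
    (hsum : ∑ a ∈ Aprime, w a ≤ 1) :
    ∃ Q ∈ AmbEx, ∀ y : Fin 10 → ℝ, ∫ c, (∑ a, c a * y a) ∂Q = ∑ a ∈ Aprime, w a * y a := by
  refine ⟨Measure.dirac fun a => if a ∈ Aprime then w a else 0,
    ⟨inferInstance, fun a ha => ?_, fun a ha => ?_, ?_⟩, fun y => ?_⟩
  · exact Measure.dirac_apply_of_mem (by simp [ha])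
  · exact Measure.dirac_apply_of_mem (by simpa [ha] using hw a ha)
  · rw [integral_dirac, Finset.sum_congr rfl fun a ha => if_pos ha]
    exact hsum
  · simp [integral_dirac, ite_mul]

/-- The worst-case expected cost of every path is `1`. -/
lemma sSup_expected_cost_eq_one {y : Fin 10 → ℝ} (hy : y ∈ Yex) :
    sSup {e | ∃ Q ∈ AmbEx, e = ∫ c, (∑ a, c a * y a) ∂Q} = 1 := by
  refine IsGreatest.csSup_eq ⟨?_, ?_⟩
  · obtain ⟨Q, hQ, hval⟩ := exists_mem_AmbEx_of_costs y
      (fun a _ => by rcases hy.1 a with h | h <;> simp [h]) (sum_Aprime_of_mem_Yex hy).le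
    refine ⟨Q, hQ, ?_⟩
    rw [hval, ← sum_Aprime_of_mem_Yex hy]
    refine Finset.sum_congr rfl fun a _ => ?_
    rcases hy.1 a with h | h <;> simp [h]
  · rintro _ ⟨Q, hQ, rfl⟩
    obtain ⟨m, hm, hsum, hval⟩ := exists_mean_of_mem_AmbEx hQ
    rw [hval]
    refine (Finset.sum_le_sum fun a _ => ?_).trans hsum
    rcases hy.1 a with h | h <;> simp [h, hm a]

/-- For every admissible distribution some path has expected cost at most `1 / 4`. -/
lemma sInf_expected_cost_le {Q : Measure (Fin 10 → ℝ)} (hQ : Q ∈ AmbEx) :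
    sInf {e | ∃ y ∈ Yex, e = ∫ c, (∑ a, c a * y a) ∂Q} ≤ 1 / 4 := by
  obtain ⟨m, hm, hsum, hval⟩ := exists_mean_of_mem_AmbEx hQ
  have hbdd : BddBelow {e | ∃ y ∈ Yex, e = ∫ c, (∑ a, c a * y a) ∂Q} := by
    refine ⟨0, ?_⟩
    rintro _ ⟨y, hy, rfl⟩
    rw [hval]
    refine Finset.sum_nonneg fun a _ => ?_
    rcases hy.1 a with h | h <;> simp [h, hm a]
  have hle : ∀ k ∈ Aprime, sInf {e | ∃ y ∈ Yex, e = ∫ c, (∑ a, c a * y a) ∂Q} ≤ m k := by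
    intro k hk
    obtain ⟨y, hy, hyk⟩ := exists_mem_Yex_of_mem_Aprime hk
    refine csInf_le hbdd ⟨y, hy, ?_⟩
    rw [hval, Finset.sum_congr rfl fun a ha => by rw [hyk a ha]]
    simp [hk]
  have hcard := (Finset.card_nsmul_le_sum _ _ _ hle).trans hsum
  rw [show Aprime.card = 4 from rfl, nsmul_eq_mul] at hcard
  push_cast at hcard
  linarith

/-- In the 8-node example network,
`min_{y∈Y} max_{Q∈Q} E_Q[cᵀy] = 1` while `max_{Q∈Q} min_{y∈Y} E_Q[cᵀy] = 1/4`. -/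
theorem example_minmax_and_maxmin :
    sInf {r | ∃ y ∈ Yex, r = sSup {e | ∃ Q ∈ AmbEx, e = ∫ c, (∑ a, c a * y a) ∂Q}} = 1 ∧
    sSup {r | ∃ Q ∈ AmbEx, r = sInf {e | ∃ y ∈ Yex, e = ∫ c, (∑ a, c a * y a) ∂Q}} = 1 / 4 := by
  obtain ⟨y₀, hy₀⟩ := Yex_nonempty
  constructor
  · refine IsLeast.csInf_eq ⟨⟨y₀, hy₀, (sSup_expected_cost_eq_one hy₀).symm⟩, ?_⟩
    rintro _ ⟨y, hy, rfl⟩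
    exact (sSup_expected_cost_eq_one hy).ge
  · refine IsGreatest.csSup_eq ⟨?_, ?_⟩
    · obtain ⟨Q, hQ, hval⟩ := exists_mem_AmbEx_of_costs (fun _ => 1 / 4)
        (fun _ _ => by norm_num) (by rw [sum_Aprime]; norm_num)
      have hconst : ∀ y ∈ Yex, ∫ c, (∑ a, c a * y a) ∂Q = 1 / 4 := fun y hy => by
        rw [hval, ← Finset.mul_sum, sum_Aprime_of_mem_Yex hy, mul_one]
      refine ⟨Q, hQ, Eq.symm ?_⟩
      refine IsLeast.csInf_eq ⟨⟨y₀, hy₀, (hconst y₀ hy₀).symm⟩, ?_⟩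
      rintro _ ⟨y, hy, rfl⟩
      exact (hconst y hy).ge
    · rintro _ ⟨Q, hQ, rfl⟩
      exact sInf_expected_cost_le hQ
end
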